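/- Let X be a paracompact Hausdorff space. Then X is a finite C-space if and only if for every Hausdorff topological space Y and every aspherical sequence φ_k : X ⇝ Y (k < ω) of lower locally constant set-valued mappings, there exists an n < ω such that φ_n has a continuous selection. -/

import Mathlib

/-- `EmbedIn k S B` means `S ↪_k B`: every continuous map from the unit `k`-sphere of
`ℝ^{k+1}` into `S` extends to a continuous map from the closed unit `(k+1)`-ball into `B`. -/
def EmbedIn {Y : Type*} [TopologicalSpace Y] (k : ℕ) (S B : Set Y) : Prop :=
  ∀ f : (Metric.sphere (0 : EuclideanSpace ℝ (Fin (k + 1))) 1) → Y,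
    Continuous f → Set.range f ⊆ S →
      ∃ g : (Metric.closedBall (0 : EuclideanSpace ℝ (Fin (k + 1))) 1) → Y,
        Continuous g ∧ Set.range g ⊆ B ∧
          ∀ z, g (Set.inclusion Metric.sphere_subset_closedBall z) = f z

/-- A set-valued mapping `Φ : X ⇝ Y` is lower locally constant if
`{x | K ⊆ Φ x}` is open for every compact `K ⊆ Y`. -/
def LowerLocallyConstant {X Y : Type*} [TopologicalSpace X] [TopologicalSpace Y]
    (Φ : X → Set Y) : Prop :=
  ∀ K : Set Y, IsCompact K → IsOpen {x | K ⊆ Φ x}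

/-- `X` is a finite C-space. -/
def IsFiniteCSpace (X : Type*) [TopologicalSpace X] : Prop :=
  ∀ U : ℕ → Set (Set X),
    (∀ n, (∀ u ∈ U n, IsOpen u) ∧ (U n).Finite ∧ ⋃₀ U n = Set.univ) →
      ∃ n : ℕ, ∃ V : ℕ → Set (Set X),
        (∀ k, k ≤ n → ∀ v ∈ V k, IsOpen v) ∧
        (∀ k, k ≤ n → (V k).Pairwise Disjoint) ∧
        (∀ k, k ≤ n → ∀ v ∈ V k, ∃ u ∈ U k, v ⊆ u) ∧
        (⋃ k ≤ n, ⋃₀ V k) = Set.univ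

section Cone

/-- A subset that absorbs every segment towards a point `e` fills all spheres. -/
theorem embedIn_of_segment {E : Type*} [AddCommGroup E] [Module ℝ E] [TopologicalSpace E]
    [IsTopologicalAddGroup E] [ContinuousSMul ℝ E] (k : ℕ) {S B : Set E} (e : E)
    (h : ∀ y ∈ S, ∀ r : ℝ, 0 ≤ r → r ≤ 1 → r • y + (1 - r) • e ∈ B) : EmbedIn k S B := by
  intro f hf hfS
  let Q : (Set.Icc (0 : ℝ) 1) × (Metric.sphere (0 : EuclideanSpace ℝ (Fin (k + 1))) 1) →
      Metric.closedBall (0 : EuclideanSpace ℝ (Fin (k + 1))) 1 :=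
    fun p => ⟨(p.1 : ℝ) • (p.2 : EuclideanSpace ℝ (Fin (k + 1))), by
      have h2 : ‖(p.2 : EuclideanSpace ℝ (Fin (k + 1)))‖ = 1 := by simp
      simp [norm_smul, h2, abs_of_nonneg p.1.2.1, p.1.2.2]⟩
  have hQc : Continuous Q := by fun_prop
  have hne : ∃ θ : EuclideanSpace ℝ (Fin (k + 1)), ‖θ‖ = 1 := exists_norm_eq _ zero_le_one
  have hQs : Function.Surjective Q := by
    intro z
    by_cases hz : (z : EuclideanSpace ℝ (Fin (k + 1))) = 0
    · obtain ⟨θ, hθ⟩ := hne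
      refine ⟨(⟨0, by simp⟩, ⟨θ, by simpa using hθ⟩), ?_⟩
      ext1
      simp [Q, hz]
    · have hz' : ‖(z : EuclideanSpace ℝ (Fin (k + 1)))‖ ≠ 0 := by simpa using hz
      refine ⟨(⟨‖(z : EuclideanSpace ℝ (Fin (k + 1)))‖, norm_nonneg _,
        mem_closedBall_zero_iff.1 z.2⟩,
        ⟨‖(z : EuclideanSpace ℝ (Fin (k + 1)))‖⁻¹ • (z : EuclideanSpace ℝ (Fin (k + 1))), by
          simp [norm_smul, hz']⟩), ?_⟩
      ext1
      simp [Q, smul_smul, hz']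
  have hQ : Topology.IsQuotientMap Q := hQc.isClosedMap.isQuotientMap hQc hQs
  let F : C((Set.Icc (0 : ℝ) 1) × (Metric.sphere (0 : EuclideanSpace ℝ (Fin (k + 1))) 1), E) :=
    ⟨fun p => (p.1 : ℝ) • f p.2 + (1 - (p.1 : ℝ)) • e, by fun_prop⟩
  have hF : Function.FactorsThrough F Q := by
    rintro ⟨⟨r, hr⟩, ⟨θ, hθ⟩⟩ ⟨⟨r', hr'⟩, ⟨θ', hθ'⟩⟩ hpq
    have h1 : r • θ = r' • θ' := congrArg Subtype.val hpq
    have hθ1 : ‖θ‖ = 1 := by simpa using hθ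
    have hθ1' : ‖θ'‖ = 1 := by simpa using hθ'
    have h2 : r = r' := by
      have := congrArg norm h1
      simpa [norm_smul, hθ1, hθ1', abs_of_nonneg hr.1, abs_of_nonneg hr'.1] using this
    subst h2
    by_cases hr0 : r = 0
    · simp [F, hr0]
    · have : θ = θ' := smul_right_injective _ hr0 h1
      subst this
      rfl
  refine ⟨hQ.lift (f := ⟨Q, hQc⟩) F hF, (hQ.lift (f := ⟨Q, hQc⟩) F hF).continuous, ?_, ?_⟩
  · rintro _ ⟨z, rfl⟩
    obtain ⟨p, rfl⟩ := hQs z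
    have : hQ.lift (f := ⟨Q, hQc⟩) F hF (Q p) = F p :=
      congrArg (fun G => G p) (hQ.lift_comp (f := ⟨Q, hQc⟩) F hF)
    rw [this]
    exact h _ (hfS ⟨_, rfl⟩) _ p.1.2.1 p.1.2.2
  · intro z
    have hz : Set.inclusion Metric.sphere_subset_closedBall z = Q (⟨1, by simp⟩, z) := by
      ext1
      simp [Q]
    rw [hz]
    have : hQ.lift (f := ⟨Q, hQc⟩) F hF (Q (⟨1, by simp⟩, z)) = F (⟨1, by simp⟩, z) :=
      congrArg (fun G => G (⟨1, by simp⟩, z)) (hQ.lift_comp (f := ⟨Q, hQc⟩) F hF)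
    rw [this]
    simp [F]

/-- The points of the join of the discrete sets `{i | x ∈ G k i}`, `k ≤ n`, with unnormalized
barycentric coordinates. -/
def coverJoin {X : Type*} (G : ℕ → ℕ → Set X) (n : ℕ) (x : X) : Set (ℕ × ℕ → ℝ) :=
  {t | (∀ p, 0 ≤ t p) ∧ (∃ p, t p ≠ 0) ∧ (∀ k i j, t (k, i) ≠ 0 → t (k, j) ≠ 0 → i = j) ∧
    ∀ k i, t (k, i) ≠ 0 → k ≤ n ∧ x ∈ G k i}

theorem coverJoin_nonempty {X : Type*} {G : ℕ → ℕ → Set X} (n : ℕ) {x : X} {i : ℕ}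
    (hi : x ∈ G n i) : Pi.single (n, i) 1 ∈ coverJoin G n x := by
  refine ⟨fun p => ?_, ⟨(n, i), by simp⟩, fun k a b ha hb => ?_, fun k a ha => ?_⟩
  · by_cases h : p = (n, i) <;> simp [h]
  · simp only [Pi.single_apply, ne_eq, ite_eq_right_iff, Prod.mk.injEq, one_ne_zero, imp_false,
      not_not] at ha hb
    rw [ha.2, hb.2]
  · simp only [Pi.single_apply, ne_eq, ite_eq_right_iff, Prod.mk.injEq, one_ne_zero, imp_false,
      not_not] at ha
    obtain ⟨rfl, rfl⟩ := ha
    exact ⟨le_rfl, hi⟩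

theorem lowerLocallyConstant_coverJoin {X : Type*} [TopologicalSpace X] {G : ℕ → ℕ → Set X}
    (hG : ∀ k i, IsOpen (G k i)) {m : ℕ → ℕ} (hm : ∀ k i x, x ∈ G k i → i < m k) (n : ℕ) :
    LowerLocallyConstant (coverJoin G n) := by
  intro K _
  rw [isOpen_iff_mem_nhds]
  intro x hx
  have : ∀ᶠ y in nhds x, ∀ k ∈ Set.Iic n, ∀ i ∈ Set.Iio (m k), x ∈ G k i → y ∈ G k i := by
    rw [Filter.eventually_all_finite (Set.finite_Iic n)]
    intro k _
    rw [Filter.eventually_all_finite (Set.finite_Iio (m k))]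
    intro i _
    by_cases hxi : x ∈ G k i
    · filter_upwards [(hG k i).mem_nhds hxi] with y hy _ using hy
    · simp [hxi]
  filter_upwards [this] with y hy t ht
  obtain ⟨h1, h2, h3, h4⟩ := hx ht
  refine ⟨h1, h2, h3, fun k i hki => ?_⟩
  obtain ⟨hk, hi⟩ := h4 k i hki
  exact ⟨hk, hy k hk i (hm k i x hi) hi⟩

theorem embedIn_coverJoin {X : Type*} {G : ℕ → ℕ → Set X} (n : ℕ) {x : X} {i : ℕ}
    (hi : x ∈ G (n + 1) i) : EmbedIn n (coverJoin G n x) (coverJoin G (n + 1) x) := by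
  refine embedIn_of_segment n (Pi.single (n + 1, i) 1) ?_
  rintro t ⟨h1, ⟨p, hp⟩, h3, h4⟩ r hr0 hr1
  have htop : ∀ j, t (n + 1, j) = 0 := by
    intro j
    by_contra hj
    have := (h4 _ _ hj).1
    omega
  have hval : ∀ q : ℕ × ℕ, (r • t + (1 - r) • (Pi.single (n + 1, i) 1 : ℕ × ℕ → ℝ)) q =
      if q = (n + 1, i) then 1 - r else r * t q := by
    intro q
    by_cases hq : q = (n + 1, i)
    · subst hq
      simp [htop]
    · simp [hq]
  refine ⟨fun q => ?_, ?_, fun k a b ha hb => ?_, fun k a ha => ?_⟩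
  · rw [hval]
    split_ifs
    · linarith
    · exact mul_nonneg hr0 (h1 q)
  · by_cases hr : r = 1
    · refine ⟨p, ?_⟩
      have : p ≠ (n + 1, i) := by
        rintro rfl
        exact hp (htop i)
      rw [hval, if_neg this, hr, one_mul]
      exact hp
    · refine ⟨(n + 1, i), ?_⟩
      rw [hval, if_pos rfl]
      exact sub_ne_zero.2 (Ne.symm hr)
  · rw [hval] at ha hb
    by_cases hk : k = n + 1
    · subst hk
      simp only [Prod.mk.injEq, true_and, htop, mul_zero, ne_eq, ite_eq_right_iff,
        not_forall] at ha hb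
      rw [ha.1, hb.1]
    · simp only [Prod.mk.injEq, hk, false_and, if_false] at ha hb
      exact h3 k a b (right_ne_zero_of_mul ha) (right_ne_zero_of_mul hb)
  · rw [hval] at ha
    by_cases hk : (k, a) = (n + 1, i)
    · simp only [Prod.mk.injEq] at hk
      obtain ⟨rfl, rfl⟩ := hk
      exact ⟨le_rfl, hi⟩
    · rw [if_neg hk] at ha
      obtain ⟨h5, h6⟩ := h4 k a (right_ne_zero_of_mul ha)
      exact ⟨by omega, h6⟩

theorem isFiniteCSpace_of_selection {X : Type*} [TopologicalSpace X]
    (H : ∀ (Y : Type) [TopologicalSpace Y] [T2Space Y] (φ : ℕ → X → Set Y),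
        (∀ k x, (φ k x).Nonempty) →
        (∀ k, LowerLocallyConstant (φ k)) →
        (∀ k x, EmbedIn k (φ k x) (φ (k + 1) x)) →
        ∃ n : ℕ, ∃ f : X → Y, Continuous f ∧ ∀ x, f x ∈ φ n x) : IsFiniteCSpace X := by
  intro U hU
  choose m e _ he using fun n => (hU n).2.1.fin_param
  have hrange : ∀ n (i : Fin (m n)), e n i ∈ U n := fun n i => by rw [← he n]; exact ⟨i, rfl⟩
  let G : ℕ → ℕ → Set X := fun n i => if h : i < m n then e n ⟨i, h⟩ else ∅
  have hG : ∀ k i, IsOpen (G k i) := by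
    intro k i
    by_cases h : i < m k
    · simpa only [G, dif_pos h] using (hU k).1 _ (hrange k _)
    · simp [G, h]
  have hm : ∀ k i x, x ∈ G k i → i < m k := by
    intro k i x hx
    by_contra h
    simp [G, h] at hx
  have hGU : ∀ k i x, x ∈ G k i → G k i ∈ U k := by
    intro k i x hx
    have h := hm k i x hx
    simpa only [G, dif_pos h] using hrange k _
  have hcov : ∀ k x, ∃ i, x ∈ G k i := by
    intro k x
    have hx : x ∈ ⋃₀ U k := by rw [(hU k).2.2]; trivial
    obtain ⟨u, hu, hxu⟩ := hx
    rw [← he k] at hu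
    obtain ⟨i, rfl⟩ := hu
    exact ⟨i, by simpa [G] using hxu⟩
  obtain ⟨n, f, hf, hfs⟩ := H (ℕ × ℕ → ℝ) (coverJoin G)
    (fun k x => ⟨_, coverJoin_nonempty k (hcov k x).choose_spec⟩)
    (lowerLocallyConstant_coverJoin hG hm)
    (fun k x => embedIn_coverJoin k (hcov (k + 1) x).choose_spec)
  refine ⟨n, fun k => {v | v.Nonempty ∧ ∃ i, v = {x | f x (k, i) ≠ 0}}, ?_, ?_, ?_, ?_⟩
  · rintro k _ _ ⟨_, i, rfl⟩
    exact isOpen_ne_fun ((continuous_apply _).comp hf) continuous_const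
  · rintro k _ _ ⟨_, i, rfl⟩ _ ⟨_, j, rfl⟩ hij
    refine Set.disjoint_left.2 fun x hx hx' => hij ?_
    rw [(hfs x).2.2.1 k i j hx hx']
  · rintro k _ _ ⟨⟨x, hx⟩, i, rfl⟩
    exact ⟨_, hGU k i x ((hfs x).2.2.2 k i hx).2, fun y hy => ((hfs y).2.2.2 k i hy).2⟩
  · refine Set.eq_univ_of_forall fun x => ?_
    obtain ⟨⟨k, i⟩, hki⟩ := (hfs x).2.1
    simp only [Set.mem_iUnion]
    exact ⟨k, ((hfs x).2.2.2 k i hki).1, _, ⟨⟨x, hki⟩, i, rfl⟩, hki⟩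

end Cone

section DisjointRefinements

variable {X : Type*} [TopologicalSpace X]

/-- `V` is a pairwise disjoint family of open sets which refines `U`. -/
def IsDisjointRefinement (V U : Set (Set X)) : Prop :=
  (∀ v ∈ V, IsOpen v) ∧ V.Pairwise Disjoint ∧ ∀ v ∈ V, ∃ u ∈ U, v ⊆ u

/-- `F` is covered by `m` pairwise disjoint families of open sets, each of which refines `U`. -/
def HasColoredCover (m : ℕ) (U : Set (Set X)) (F : Set X) : Prop :=
  ∃ V : ℕ → Set (Set X), (∀ k, IsDisjointRefinement (V k) U) ∧
    ∀ x ∈ F, ∃ k < m, x ∈ ⋃₀ V k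

theorem isDisjointRefinement_empty (U : Set (Set X)) : IsDisjointRefinement ∅ U :=
  ⟨by simp, by simp, by simp⟩

theorem HasColoredCover.mono {m : ℕ} {U : Set (Set X)} {F F' : Set X}
    (h : HasColoredCover m U F) (hF : F' ⊆ F) : HasColoredCover m U F' := by
  obtain ⟨V, h1, h2⟩ := h
  exact ⟨V, h1, fun x hx => h2 x (hF hx)⟩

theorem HasColoredCover.union {m m' : ℕ} {U : Set (Set X)} {F F' : Set X}
    (h : HasColoredCover m U F) (h' : HasColoredCover m' U F') :
    HasColoredCover (m + m') U (F ∪ F') := by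
  obtain ⟨V, h1, h2⟩ := h
  obtain ⟨V', h1', h2'⟩ := h'
  refine ⟨fun k => if k < m then V k else V' (k - m), fun k => ?_, ?_⟩
  · dsimp only
    split_ifs
    exacts [h1 _, h1' _]
  · rintro x (hx | hx)
    · obtain ⟨k, hk, hxk⟩ := h2 x hx
      exact ⟨k, by omega, by simpa [hk] using hxk⟩
    · obtain ⟨k, hk, hxk⟩ := h2' x hx
      exact ⟨m + k, by omega, by simpa using hxk⟩

theorem HasColoredCover.biUnion {U : Set (Set X)} {m : ℕ → ℕ} {F : ℕ → Set X} (n : ℕ)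
    (h : ∀ i < n, HasColoredCover (m i) U (F i)) :
    HasColoredCover (∑ i ∈ Finset.range n, m i) U (⋃ i < n, F i) := by
  induction n with
  | zero => exact ⟨fun _ => ∅, fun _ => isDisjointRefinement_empty U, by simp⟩
  | succ n ih =>
    rw [Finset.sum_range_succ]
    refine ((ih fun i hi => h i (by omega)).union (h n (by omega))).mono ?_
    intro x hx
    simp only [Set.mem_iUnion] at hx
    obtain ⟨i, hi, hxi⟩ := hx
    rcases Nat.lt_succ_iff_lt_or_eq.1 hi with hi | rfl
    · left
      simp only [Set.mem_iUnion]
      exact ⟨i, hi, hxi⟩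
    · exact Or.inr hxi

theorem HasColoredCover.iUnion {ι : Type*} {m : ℕ} {U : Set (Set X)} {F O : ι → Set X}
    (h : ∀ i, HasColoredCover m U (F i)) (hO : ∀ i, IsOpen (O i))
    (hd : Pairwise (Function.onFun Disjoint O)) (hFO : ∀ i, F i ⊆ O i) :
    HasColoredCover m U (⋃ i, F i) := by
  choose V h1 h2 using h
  refine ⟨fun k => {w | ∃ i, ∃ v ∈ V i k, w = v ∩ O i}, fun k => ⟨?_, ?_, ?_⟩, ?_⟩
  · rintro _ ⟨i, v, hv, rfl⟩
    exact ((h1 i k).1 v hv).inter (hO i)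
  · rintro _ ⟨i, v, hv, rfl⟩ _ ⟨j, w, hw, rfl⟩ hne
    by_cases hij : i = j
    · subst hij
      have hvw : v ≠ w := by rintro rfl; exact hne rfl
      exact ((h1 i k).2.1 hv hw hvw).mono Set.inter_subset_left Set.inter_subset_left
    · exact (hd hij).mono Set.inter_subset_right Set.inter_subset_right
  · rintro _ ⟨i, v, hv, rfl⟩
    obtain ⟨u, hu, hvu⟩ := (h1 i k).2.2 v hv
    exact ⟨u, hu, Set.inter_subset_left.trans hvu⟩
  · intro x hx
    obtain ⟨i, hi⟩ := Set.mem_iUnion.1 hx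
    obtain ⟨k, hk, v, hv, hxv⟩ := h2 i x hi
    exact ⟨k, hk, v ∩ O i, ⟨i, v, hv, rfl⟩, hxv, hFO i hi⟩

/-- Members of a disjoint family can be cut along disjoint families whose unions contain them. -/
theorem exists_isDisjointRefinement_split {ι : Type*} {U V : Set (Set X)} {G : ι → Set (Set X)}
    (hVo : ∀ v ∈ V, IsOpen v) (hV : V.Pairwise Disjoint)
    (hG : ∀ i, IsDisjointRefinement (G i) U) :
    ∃ W, IsDisjointRefinement W U ∧ ∀ v ∈ V, (∃ i, v ⊆ ⋃₀ G i) → v ⊆ ⋃₀ W := by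
  refine ⟨{w | ∃ v ∈ V, ∃ h : ∃ i, v ⊆ ⋃₀ G i, ∃ g ∈ G h.choose, w = v ∩ g}, ⟨?_, ?_, ?_⟩, ?_⟩
  · rintro _ ⟨v, hv, h, g, hg, rfl⟩
    exact (hVo v hv).inter ((hG _).1 g hg)
  · rintro _ ⟨v, hv, h, g, hg, rfl⟩ _ ⟨v', hv', h', g', hg', rfl⟩ hne
    by_cases hvv : v = v'
    · subst hvv
      have hgg : g ≠ g' := by rintro rfl; exact hne rfl
      exact ((hG _).2.1 hg hg' hgg).mono Set.inter_subset_right Set.inter_subset_right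
    · exact (hV hv hv' hvv).mono Set.inter_subset_left Set.inter_subset_left
  · rintro _ ⟨v, hv, h, g, hg, rfl⟩
    obtain ⟨u, hu, hgu⟩ := (hG _).2.2 g hg
    exact ⟨u, hu, Set.inter_subset_right.trans hgu⟩
  · intro v hv h x hx
    obtain ⟨g, hg, hxg⟩ := h.choose_spec hx
    exact ⟨v ∩ g, ⟨v, hv, h, g, hg, rfl⟩, hx, hxg⟩

theorem HasColoredCover.split {ι : Type*} {m : ℕ} {U : Set (Set X)} {F : Set X}
    {G : ι → Set (Set X)} (hG : ∀ i, IsDisjointRefinement (G i) U)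
    (h : HasColoredCover m (Set.range fun i => ⋃₀ G i) F) : HasColoredCover m U F := by
  obtain ⟨V, h1, h2⟩ := h
  choose W hW hVW using fun k => exists_isDisjointRefinement_split (h1 k).1 (h1 k).2.1 hG
  refine ⟨W, hW, fun x hx => ?_⟩
  obtain ⟨k, hk, v, hv, hxv⟩ := h2 x hx
  refine ⟨k, hk, hVW k v hv ?_ hxv⟩
  obtain ⟨_, ⟨i, rfl⟩, hvi⟩ := (h1 k).2.2 v hv
  exact ⟨i, hvi⟩

/-- Sets which are well coverable over each ring `{j ≤ s ≤ j + 1}` are coverable. -/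
theorem HasColoredCover.of_rings {m : ℕ} {U : Set (Set X)} {A : Set X} {s : X → ℝ}
    (hs : Continuous s) (J : ℕ)
    (h : ∀ j : ℕ, J ≤ j → HasColoredCover m U (A ∩ {x | (j : ℝ) ≤ s x ∧ s x ≤ j + 1})) :
    HasColoredCover (m + m) U (A ∩ {x | (J : ℝ) ≤ s x}) := by
  have key : ∀ p : ℕ, J ≤ p → HasColoredCover m U
      (⋃ j : ℕ, A ∩ {x | ((p + 2 * j : ℕ) : ℝ) ≤ s x ∧ s x ≤ ((p + 2 * j : ℕ) : ℝ) + 1}) := by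
    intro p hp
    refine HasColoredCover.iUnion
      (O := fun j : ℕ => {x | ((p + 2 * j : ℕ) : ℝ) - 1 / 2 < s x ∧
        s x < ((p + 2 * j : ℕ) : ℝ) + 3 / 2})
      (fun j => h _ (by omega)) (fun j => ?_) ?_ (fun j x hx => ?_)
    · exact (isOpen_lt continuous_const hs).inter (isOpen_lt hs continuous_const)
    · intro i j hij
      refine Set.disjoint_left.2 fun x hx hx' => hij ?_
      simp only [Set.mem_ofPred_eq] at hx hx'
      have h1 : ((p + 2 * i : ℕ) : ℝ) < ((p + 2 * j : ℕ) : ℝ) + 2 := by linarith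
      have h2 : ((p + 2 * j : ℕ) : ℝ) < ((p + 2 * i : ℕ) : ℝ) + 2 := by linarith
      norm_cast at h1 h2
      omega
    · obtain ⟨-, h1, h2⟩ := hx
      constructor <;> linarith
  refine ((key J le_rfl).union (key (J + 1) (by omega))).mono ?_
  rintro x ⟨hxA, hx⟩
  have hx : (J : ℝ) ≤ s x := hx
  have h0 : 0 ≤ s x := (Nat.cast_nonneg J).trans hx
  have h1 := Nat.floor_le h0
  have h2 := (Nat.lt_floor_add_one (s x)).le
  have h3 : J ≤ ⌊s x⌋₊ := Nat.le_floor hx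
  obtain ⟨d, hd⟩ := Nat.exists_eq_add_of_le h3
  rcases Nat.even_or_odd' d with ⟨c, hc | hc⟩
  · left
    refine Set.mem_iUnion.2 ⟨c, hxA, ?_⟩
    rw [show J + 2 * c = ⌊s x⌋₊ by omega]
    exact ⟨h1, h2⟩
  · right
    refine Set.mem_iUnion.2 ⟨c, hxA, ?_⟩
    rw [show J + 1 + 2 * c = ⌊s x⌋₊ by omega]
    exact ⟨h1, h2⟩

end DisjointRefinements

section Perturbation

variable {X : Type*} [TopologicalSpace X]

/-- Any sequence of real functions has arbitrarily close approximations whose first `m` members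
have, uniformly, no common zero on `F`. For closed subsets of normal spaces this amounts to
`dim F < m`. -/
def Perturbable (m : ℕ) (F : Set X) : Prop :=
  ∀ f : ℕ → C(X, ℝ), ∀ ε > 0, ∃ g : ℕ → C(X, ℝ), (∀ i x, |f i x - g i x| ≤ 2 * ε) ∧
    ∀ x ∈ F, ∃ i < m, ε ≤ |g i x|

theorem Perturbable.mono {m : ℕ} {F F' : Set X} (h : Perturbable m F) (hF : F' ⊆ F) :
    Perturbable m F' := by
  intro f ε hε
  obtain ⟨g, h1, h2⟩ := h f ε hε
  exact ⟨g, h1, fun x hx => h2 x (hF hx)⟩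

theorem Perturbable.exists_finset {m : ℕ} {F : Set X} (h : Perturbable m F)
    (T : Finset (Finset ℕ)) (hT : ∀ t ∈ T, t.card = m) (f : ℕ → C(X, ℝ)) {ε : ℝ} (hε : 0 < ε) :
    ∃ g : ℕ → C(X, ℝ), ∃ δ > 0, (∀ i x, |f i x - g i x| ≤ ε) ∧
      ∀ t ∈ T, ∀ x ∈ F, ∃ i ∈ t, δ ≤ |g i x| := by
  classical
  induction T using Finset.induction_on generalizing ε with
  | empty => exact ⟨f, 1, one_pos, by simp [hε.le], by simp⟩
  | insert t T _ ih =>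
    obtain ⟨g, δ, hδ, hfg, hg⟩ := ih (fun s hs => hT s (Finset.mem_insert_of_mem hs)) (half_pos hε)
    let e := t.equivFinOfCardEq (hT t (Finset.mem_insert_self _ _))
    obtain ⟨g', h1, h2⟩ := h (fun i => if hi : i < m then g (e.symm ⟨i, hi⟩) else 0)
      (min δ ε / 8) (by positivity)
    have hδ' := min_le_left δ ε
    have hε' := min_le_right δ ε
    have hpos : 0 < min δ ε := lt_min hδ hε
    let g'' : ℕ → C(X, ℝ) := fun j => if hj : j ∈ t then g' (e ⟨j, hj⟩) else g j
    have hclose : ∀ i x, |g i x - g'' i x| ≤ min δ ε / 4 := by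
      intro i x
      by_cases hi : i ∈ t
      · have := h1 (e ⟨i, hi⟩) x
        simp only [Fin.is_lt, dif_pos, Fin.eta, Equiv.symm_apply_apply] at this
        simp only [g'', dif_pos hi]
        linarith
      · simp only [g'', dif_neg hi, sub_self, abs_zero]
        linarith
    refine ⟨g'', min δ ε / 8, by positivity, fun i x => ?_, fun s hs x hx => ?_⟩
    · have := abs_sub_le (f i x) (g i x) (g'' i x)
      have := hfg i x
      have := hclose i x
      linarith
    · rcases Finset.mem_insert.1 hs with rfl | hs
      · obtain ⟨i, hi, hix⟩ := h2 x hx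
        refine ⟨e.symm ⟨i, hi⟩, (e.symm ⟨i, hi⟩).2, ?_⟩
        simpa [g''] using hix
      · obtain ⟨i, hi, hix⟩ := hg s hs x hx
        refine ⟨i, hi, ?_⟩
        have := hclose i x
        have := abs_sub_abs_le_abs_sub (g i x) (g'' i x)
        linarith

/-- A perturbable closed set has colored covers subordinated to any finite open cover. -/
theorem Perturbable.hasColoredCover_finite [NormalSpace X] {m : ℕ} {F : Set X}
    (h : Perturbable m F) (hF : IsClosed F) {G : ℕ → Set X} (hG : ∀ i, IsOpen (G i)) (N : ℕ)
    (hFG : F ⊆ ⋃ i < N, G i) : HasColoredCover m (Set.range G) F := by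
  classical
  obtain ⟨C, hFC, hC, hCG⟩ := exists_subset_iUnion_closed_subset (u := fun i : Fin N => G i) hF
    (fun i => hG i) (fun x _ => Set.toFinite _) (by
      intro x hx
      have := hFG hx
      simp only [Set.mem_iUnion] at this ⊢
      obtain ⟨i, hi, hx⟩ := this
      exact ⟨⟨i, hi⟩, hx⟩)
  have hf : ∀ i : ℕ, ∃ f : C(X, ℝ), (∀ x, x ∉ G i → f x = -1) ∧
      ∀ hi : i < N, ∀ x ∈ C ⟨i, hi⟩, f x = 1 := by
    intro i
    by_cases hi : i < N
    · obtain ⟨f, h1, h2, -⟩ := exists_bounded_mem_Icc_of_closed_of_le (hG i).isClosed_compl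
        (hC ⟨i, hi⟩) (Set.disjoint_left.2 fun x hx hx' => hx (hCG _ hx'))
        (show (-1 : ℝ) ≤ 1 by norm_num)
      exact ⟨f, fun x hx => h1 hx, fun _ x hx => h2 hx⟩
    · exact ⟨-1, by simp, fun h => absurd h hi⟩
  choose f hf1 hf2 using hf
  obtain ⟨g, δ, hδ, hfg, hg⟩ := h.exists_finset ((Finset.range N).powersetCard m)
    (fun t ht => (Finset.mem_powersetCard.1 ht).2) f (show (0 : ℝ) < 1 / 2 by norm_num)
  have hgG : ∀ i x, 0 < g i x → x ∈ G i := by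
    intro i x hx
    by_contra hxi
    have := hfg i x
    rw [hf1 i x hxi, abs_le] at this
    linarith
  have hgC : ∀ x ∈ F, ∃ i < N, 0 < g i x := by
    intro x hx
    obtain ⟨⟨i, hi⟩, hxi⟩ := Set.mem_iUnion.1 (hFC hx)
    refine ⟨i, hi, ?_⟩
    have := hfg i x
    rw [hf2 i hi x hxi, abs_le] at this
    linarith
  let w : Finset ℕ → ℕ → Set X := fun t i => {x | 0 < g i x ∧
    (∀ j ∈ Finset.range N \ t, g j x ≠ 0 ∧ (j < i → g j x < 0) ∧ ∀ l ∈ t, |g l x| < |g j x|)}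
  have hwo : ∀ t i, IsOpen (w t i) := by
    intro t i
    refine (isOpen_lt continuous_const (g i).continuous).inter ?_
    have : {x | ∀ j ∈ Finset.range N \ t,
        g j x ≠ 0 ∧ (j < i → g j x < 0) ∧ ∀ l ∈ t, |g l x| < |g j x|} =
        ⋂ j ∈ Finset.range N \ t, ({x | g j x ≠ 0} ∩ ({x | j < i → g j x < 0} ∩
          ⋂ l ∈ t, {x | |g l x| < |g j x|})) := by
      ext x; simp
    change IsOpen {x | ∀ j ∈ Finset.range N \ t,
        g j x ≠ 0 ∧ (j < i → g j x < 0) ∧ ∀ l ∈ t, |g l x| < |g j x|}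
    rw [this]
    refine isOpen_biInter_finset fun j _ => ((isOpen_ne_fun (g j).continuous
      continuous_const).inter (IsOpen.inter ?_ (isOpen_biInter_finset fun l _ =>
        isOpen_lt (g l).continuous.abs (g j).continuous.abs)))
    by_cases hji : j < i
    · simpa [hji] using isOpen_lt (g j).continuous continuous_const
    · simp [hji]
  refine ⟨fun k => {v | ∃ t ⊆ Finset.range N, t.card = k ∧ ∃ i ∈ Finset.range N \ t, v = w t i},
    fun k => ⟨?_, ?_, ?_⟩, fun x hx => ?_⟩
  · rintro _ ⟨t, -, -, i, -, rfl⟩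
    exact hwo t i
  · rintro _ ⟨t, ht, htk, i, hi, rfl⟩ _ ⟨t', ht', htk', i', hi', rfl⟩ hne
    refine Set.disjoint_left.2 fun x hx hx' => hne ?_
    obtain ⟨hx1, hx2⟩ := hx
    obtain ⟨hx1', hx2'⟩ := hx'
    have htt : t = t' := by
      by_contra htt
      have h1 : ¬ t ⊆ t' := fun hs => htt (Finset.eq_of_subset_of_card_le hs (by omega))
      have h2 : ¬ t' ⊆ t := fun hs => htt (Finset.eq_of_subset_of_card_le hs (by omega)).symm
      obtain ⟨l, hl, hl'⟩ := Finset.not_subset.1 h1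
      obtain ⟨j, hj, hj'⟩ := Finset.not_subset.1 h2
      exact lt_asymm ((hx2 j (Finset.mem_sdiff.2 ⟨ht' hj, hj'⟩)).2.2 l hl)
        ((hx2' l (Finset.mem_sdiff.2 ⟨ht hl, hl'⟩)).2.2 j hj)
    subst htt
    have hii : i = i' := by
      rcases lt_trichotomy i i' with hlt | heq | hlt
      · exact absurd ((hx2' i hi).2.1 hlt) (not_lt.2 hx1.le)
      · exact heq
      · exact absurd ((hx2 i' hi').2.1 hlt) (not_lt.2 hx1'.le)
    rw [hii]
  · rintro _ ⟨t, -, -, i, -, rfl⟩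
    exact ⟨G i, ⟨i, rfl⟩, fun x hx => hgG i x hx.1⟩
  · let t := (Finset.range N).filter fun j => g j x = 0
    have ht : t ⊆ Finset.range N := Finset.filter_subset _ _
    have htm : t.card < m := by
      by_contra hlt
      obtain ⟨s, hs, hsm⟩ := Finset.exists_subset_card_eq (not_lt.1 hlt)
      obtain ⟨i, hi, hix⟩ := hg s (Finset.mem_powersetCard.2 ⟨hs.trans ht, hsm⟩) x hx
      have : g i x = 0 := (Finset.mem_filter.1 (hs hi)).2
      rw [this, abs_zero] at hix
      linarith
    have hex := hgC x hx
    obtain ⟨hi1, hi2⟩ := Nat.find_spec hex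
    refine ⟨t.card, htm, w t (Nat.find hex), ⟨t, ht, rfl, Nat.find hex, ?_, rfl⟩, hi2, ?_⟩
    · simp [t, hi1, hi2.ne']
    · intro j hj
      have hj' : j < N ∧ g j x ≠ 0 := by
        simp only [t, Finset.mem_sdiff, Finset.mem_range, Finset.mem_filter, not_and] at hj
        exact ⟨hj.1, hj.2 hj.1⟩
      refine ⟨hj'.2, fun hlt => ?_, fun l hl => ?_⟩
      · have := Nat.find_min hex hlt
        push Not at this
        exact lt_of_le_of_ne (this hj'.1) hj'.2
      · rw [(Finset.mem_filter.1 hl).2, abs_zero]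
        exact abs_pos.2 hj'.2

end Perturbation

section CountableCovers

variable {X : Type*} [TopologicalSpace X] [NormalSpace X] [ParacompactSpace X]

/-- Every open cover of a paracompact space has a refinement which is a countable union of
disjoint open families. -/
theorem exists_seq_isDisjointRefinement {U : Set (Set X)} (hU : ∀ u ∈ U, IsOpen u)
    (hcov : ⋃₀ U = Set.univ) :
    ∃ G : ℕ → Set (Set X), (∀ k, IsDisjointRefinement (G k) U) ∧ ∀ x, ∃ k, x ∈ ⋃₀ G k := by
  classical
  obtain ⟨p, hp⟩ := PartitionOfUnity.exists_isSubordinate (isClosed_univ (X := X))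
    (fun u : U => (u : Set X)) (fun u => hU u u.2) (by rw [← Set.sUnion_eq_iUnion, hcov])
  let w : Finset U → Set X := fun t => {x | ∀ i ∈ t, 0 < p i x ∧ ∀ j ∉ t, p j x < p i x}
  have hwo : ∀ t, IsOpen (w t) := by
    intro t
    rw [isOpen_iff_mem_nhds]
    intro x hx
    have h1 : ∀ᶠ y in nhds x, ∀ i ∈ t, 0 < p i y :=
      (Filter.eventually_all_finset t).2 fun i hi =>
        (p i).continuous.continuousAt.eventually_const_lt (hx i hi).1
    have h2 : ∀ᶠ y in nhds x, ∀ i ∈ t, ∀ j ∈ p.fintsupport x \ t, p j y < p i y :=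
      (Filter.eventually_all_finset t).2 fun i hi => (Filter.eventually_all_finset _).2 fun j hj =>
        (p j).continuous.continuousAt.eventually_lt (p i).continuous.continuousAt
          ((hx i hi).2 j (Finset.mem_sdiff.1 hj).2)
    filter_upwards [h1, h2, p.eventually_finsupport_subset x] with y hy1 hy2 hy3 i hi
    refine ⟨hy1 i hi, fun j hj => ?_⟩
    by_cases hjy : p j y = 0
    · rw [hjy]
      exact hy1 i hi
    · exact hy2 i hi j (Finset.mem_sdiff.2 ⟨hy3 ((p.mem_finsupport y).2 hjy), hj⟩)
  refine ⟨fun k => {v | ∃ t : Finset U, t.card = k + 1 ∧ v = w t}, fun k => ⟨?_, ?_, ?_⟩,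
    fun x => ?_⟩
  · rintro _ ⟨t, -, rfl⟩
    exact hwo t
  · rintro _ ⟨t, ht, rfl⟩ _ ⟨t', ht', rfl⟩ hne
    refine Set.disjoint_left.2 fun x hx hx' => hne ?_
    have htt : t = t' := by
      by_contra htt
      have h1 : ¬ t ⊆ t' := fun hs => htt (Finset.eq_of_subset_of_card_le hs (by omega))
      have h2 : ¬ t' ⊆ t := fun hs => htt (Finset.eq_of_subset_of_card_le hs (by omega)).symm
      obtain ⟨l, hl, hl'⟩ := Finset.not_subset.1 h1
      obtain ⟨j, hj, hj'⟩ := Finset.not_subset.1 h2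
      exact lt_asymm ((hx l hl).2 j hj') ((hx' j hj).2 l hl')
    rw [htt]
  · rintro _ ⟨t, ht, rfl⟩
    obtain ⟨i, hi⟩ := Finset.card_pos.1 (show 0 < t.card by omega)
    exact ⟨i, i.2, fun x hx => hp i (subset_tsupport _ (hx i hi).1.ne')⟩
  · obtain ⟨i, hi⟩ := p.exists_pos (Set.mem_univ x)
    have hc : 0 < (p.finsupport x).card :=
      Finset.card_pos.2 ⟨i, (p.mem_finsupport x).2 hi.ne'⟩
    refine ⟨(p.finsupport x).card - 1, w (p.finsupport x), ⟨_, by omega, rfl⟩, fun j hj => ?_⟩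
    have hj0 : 0 < p j x := lt_of_le_of_ne (p.nonneg j x) (Ne.symm ((p.mem_finsupport x).1 hj))
    refine ⟨hj0, fun l hl => ?_⟩
    have : p l x = 0 := by
      by_contra h
      exact hl ((p.mem_finsupport x).2 h)
    rwa [this]

/-- A countable open cover has a continuous function bounding the index of the members
containing a point. -/
theorem exists_continuous_index_bound {H : ℕ → Set X} (hH : ∀ k, IsOpen (H k))
    (hcov : ∀ x, ∃ k, x ∈ H k) :
    ∃ s : X → ℝ, Continuous s ∧ (∀ x, 0 ≤ s x) ∧
      ∀ x, ∀ k : ℕ, s x ≤ k + 1 → ∃ i < k + 1, x ∈ H i := by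
  obtain ⟨q, hq⟩ := PartitionOfUnity.exists_isSubordinate (isClosed_univ (X := X)) H hH
    (fun x _ => Set.mem_iUnion.2 (hcov x))
  have hconv : ∀ x, ∀ c : ℝ, (∀ i : ℕ, q i x ≠ 0 → c ≤ (i : ℝ) + 1) →
      c ≤ ∑ᶠ i : ℕ, q i x • ((i : ℝ) + 1) := fun x c hc =>
    q.finsum_smul_mem_convex (g := fun (i : ℕ) _ => (i : ℝ) + 1) (t := Set.Ici c)
      (Set.mem_univ x) hc (convex_Ici c)
  refine ⟨fun x => ∑ᶠ i : ℕ, q i x • ((i : ℝ) + 1),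
    q.continuous_finsum_smul fun _ _ _ => continuousAt_const,
    fun x => hconv x 0 fun i _ => by positivity, fun x k hk => ?_⟩
  by_contra hx
  push Not at hx
  have := hconv x (k + 2) fun i hi => ?_
  · linarith
  · have hik : k + 1 ≤ i := by
      by_contra hlt
      exact hx i (by omega) (hq i (subset_tsupport _ hi))
    have : ((k + 1 : ℕ) : ℝ) ≤ i := Nat.cast_le.2 hik
    push_cast at this
    linarith

theorem Perturbable.hasColoredCover {m : ℕ} {F : Set X} (h : Perturbable m F) (hF : IsClosed F)
    {U : Set (Set X)} (hU : ∀ u ∈ U, IsOpen u) (hcov : ⋃₀ U = Set.univ) :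
    HasColoredCover (m + m) U F := by
  obtain ⟨G, hG, hGcov⟩ := exists_seq_isDisjointRefinement hU hcov
  have hGo : ∀ k, IsOpen (⋃₀ G k) := fun k => isOpen_sUnion (hG k).1
  obtain ⟨s, hs, hs0, hsG⟩ := exists_continuous_index_bound hGo hGcov
  refine HasColoredCover.split hG ((HasColoredCover.of_rings hs 0 (A := F) fun j _ => ?_).mono ?_)
  · refine (h.mono Set.inter_subset_left).hasColoredCover_finite (hF.inter
      ((isClosed_le continuous_const hs).inter (isClosed_le hs continuous_const))) hGo (j + 1) ?_
    rintro x ⟨-, -, hx⟩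
    obtain ⟨i, hi, hxi⟩ := hsG x j hx
    simp only [Set.mem_iUnion]
    exact ⟨i, hi, hxi⟩
  · intro x hx
    exact ⟨hx, by simpa using hs0 x⟩

end CountableCovers

section FiniteC

variable {X : Type*} [TopologicalSpace X]

theorem IsFiniteCSpace.exists_perturbable [NormalSpace X] (h : IsFiniteCSpace X)
    {F : ℕ → Set X} (hF : ∀ m, IsClosed (F m)) (hlf : LocallyFinite F)
    (hd : Pairwise (Function.onFun Disjoint F)) : ∃ m, Perturbable m (F m) := by
  by_contra! hcon
  simp only [Perturbable] at hcon
  push Not at hcon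
  choose f ε hε hfail using hcon
  let A : ℕ → Set X := fun i => ⋃ m, F m ∩ {x | ε m ≤ f m i x}
  let B : ℕ → Set X := fun i => ⋃ m, F m ∩ {x | f m i x ≤ -ε m}
  have hA : ∀ i, IsClosed (A i) := fun i =>
    (hlf.subset fun m => Set.inter_subset_left).isClosed_iUnion fun m =>
      (hF m).inter (isClosed_le continuous_const (f m i).continuous)
  have hB : ∀ i, IsClosed (B i) := fun i =>
    (hlf.subset fun m => Set.inter_subset_left).isClosed_iUnion fun m =>
      (hF m).inter (isClosed_le (f m i).continuous continuous_const)
  have hAB : ∀ i x, x ∈ A i → x ∉ B i := by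
    intro i x hxA hxB
    obtain ⟨m, hm, hm'⟩ := Set.mem_iUnion.1 hxA
    obtain ⟨l, hl, hl'⟩ := Set.mem_iUnion.1 hxB
    have hml : m = l := by
      by_contra hne
      exact Set.disjoint_left.1 (hd hne) hm hl
    subst hml
    have h1 : ε m ≤ f m i x := hm'
    have h2 : f m i x ≤ -ε m := hl'
    have := hε m
    linarith
  obtain ⟨N, V, hVo, hVd, hVr, hVc⟩ := h (fun i => {(A i)ᶜ, (B i)ᶜ}) fun i => by
    refine ⟨?_, by simp, ?_⟩
    · rintro u (rfl | rfl)
      exacts [(hA i).isOpen_compl, (hB i).isOpen_compl]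
    · rw [Set.sUnion_pair]
      refine Set.eq_univ_of_forall fun x => ?_
      by_cases hx : x ∈ A i
      · exact Or.inr (hAB i x hx)
      · exact Or.inl hx
  let P : ℕ → Set X := fun i => ⋃₀ {v | v ∈ V i ∧ v ⊆ (B i)ᶜ}
  let Q : ℕ → Set X := fun i => ⋃₀ {v | v ∈ V i ∧ ¬ v ⊆ (B i)ᶜ}
  have hPo : ∀ i ≤ N, IsOpen (P i) := fun i hi => isOpen_sUnion fun v hv => hVo i hi v hv.1
  have hQo : ∀ i ≤ N, IsOpen (Q i) := fun i hi => isOpen_sUnion fun v hv => hVo i hi v hv.1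
  have hPB : ∀ i x, x ∈ P i → x ∉ B i := by
    rintro i x ⟨v, ⟨-, hv⟩, hx⟩
    exact hv hx
  have hQA : ∀ i ≤ N, ∀ x ∈ Q i, x ∉ A i := by
    rintro i hi x ⟨v, ⟨hv1, hv2⟩, hx⟩
    obtain ⟨u, hu, hvu⟩ := hVr i hi v hv1
    rcases hu with rfl | rfl
    · exact hvu hx
    · exact absurd hvu hv2
  have hPQ : ∀ i ≤ N, ∀ x ∈ P i, x ∉ Q i := by
    rintro i hi x ⟨v, ⟨hv1, hv2⟩, hx⟩ ⟨v', ⟨hv1', hv2'⟩, hx'⟩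
    have hne : v ≠ v' := by rintro rfl; exact hv2' hv2
    exact Set.disjoint_left.1 (hVd i hi hv1 hv1' hne) hx hx'
  obtain ⟨C, hCcov, hC, hCPQ⟩ := exists_subset_iUnion_closed_subset
    (u := fun i : Fin (N + 1) => P i ∪ Q i) isClosed_univ
    (fun i => (hPo i (by omega)).union (hQo i (by omega))) (fun x _ => Set.toFinite _) (by
      intro x _
      have hx : x ∈ ⋃ k ≤ N, ⋃₀ V k := by rw [hVc]; trivial
      simp only [Set.mem_iUnion] at hx ⊢
      obtain ⟨k, hk, v, hv, hxv⟩ := hx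
      refine ⟨⟨k, by omega⟩, ?_⟩
      by_cases hvB : v ⊆ (B k)ᶜ
      · exact Or.inl ⟨v, ⟨hv, hvB⟩, hxv⟩
      · exact Or.inr ⟨v, ⟨hv, hvB⟩, hxv⟩)
  have hh : ∀ i : ℕ, ∃ h : C(X, ℝ), (∀ x, |h x| ≤ 1) ∧ ∀ hi : i < N + 1,
      (∀ x ∈ A i, h x = 1) ∧ (∀ x ∈ B i, h x = -1) ∧ ∀ x ∈ C ⟨i, hi⟩, |h x| = 1 := by
    intro i
    by_cases hi : i < N + 1
    · have hiN : i ≤ N := by omega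
      obtain ⟨h, h1, h2, h3⟩ := exists_bounded_mem_Icc_of_closed_of_le
        (s := B i ∪ C ⟨i, hi⟩ ∩ (P i)ᶜ) (t := A i ∪ C ⟨i, hi⟩ ∩ (Q i)ᶜ)
        ((hB i).union ((hC _).inter (hPo i hiN).isClosed_compl))
        ((hA i).union ((hC _).inter (hQo i hiN).isClosed_compl)) (by
          refine Set.disjoint_left.2 ?_
          rintro x (hx | ⟨hx, hx'⟩) (hy | ⟨hy, hy'⟩)
          · exact hAB i x hy hx
          · exact (hCPQ _ hy).elim (fun hP => hPB i x hP hx) hy'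
          · exact (hCPQ _ hx).elim hx' (fun hQ => hQA i hiN x hQ hy)
          · exact (hCPQ _ hx).elim hx' hy')
        (show (-1 : ℝ) ≤ 1 by norm_num)
      refine ⟨h, fun x => abs_le.2 (h3 x), fun _ => ⟨fun x hx => h2 (Or.inl hx),
        fun x hx => h1 (Or.inl hx), fun x hx => ?_⟩⟩
      by_cases hxP : x ∈ P i
      · have : h x = 1 := h2 (Or.inr ⟨hx, hPQ i hiN x hxP⟩)
        simp [this]
      · have : h x = -1 := h1 (Or.inr ⟨hx, hxP⟩)
        simp [this]
    · exact ⟨0, by simp, fun hi' => absurd hi' hi⟩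
  choose η hη1 hη2 using hh
  obtain ⟨x, hxF, hx⟩ := hfail (N + 1) (fun i => ⟨fun x => f (N + 1) i x -
      max (-ε (N + 1)) (min (ε (N + 1)) (f (N + 1) i x)) + ε (N + 1) * η i x, by fun_prop⟩) (by
    intro i x
    have h1 := abs_le.1 (hη1 i x)
    have hε' := hε (N + 1)
    have h2 : |ε (N + 1) * η i x| ≤ ε (N + 1) := by
      rw [abs_mul, abs_of_pos hε']
      exact mul_le_of_le_one_right hε'.le (hη1 i x)
    have h2 := abs_le.1 h2
    have h3 : max (-ε (N + 1)) (min (ε (N + 1)) (f (N + 1) i x)) ≤ ε (N + 1) :=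
      max_le (by linarith) (min_le_left _ _)
    have h4 := le_max_left (-ε (N + 1)) (min (ε (N + 1)) (f (N + 1) i x))
    simp only [ContinuousMap.coe_mk]
    rw [abs_le]
    constructor <;> linarith)
  obtain ⟨⟨i, hi⟩, hxi⟩ := Set.mem_iUnion.1 (hCcov (Set.mem_univ x))
  have hlt := hx i hi
  simp only [ContinuousMap.coe_mk] at hlt
  have hε' := hε (N + 1)
  obtain ⟨hη3, hη4, hη5⟩ := hη2 i hi
  rcases le_or_gt (ε (N + 1)) (f (N + 1) i x) with hc | hc
  · rw [min_eq_left hc, max_eq_right (by linarith), hη3 x (Set.mem_iUnion.2 ⟨N + 1, hxF, hc⟩),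
      abs_lt] at hlt
    linarith
  rcases le_or_gt (f (N + 1) i x) (-ε (N + 1)) with hc' | hc'
  · rw [min_eq_right hc.le, max_eq_left hc', hη4 x (Set.mem_iUnion.2 ⟨N + 1, hxF, hc'⟩),
      abs_lt] at hlt
    linarith
  · rw [min_eq_right hc.le, max_eq_right hc'.le, sub_self, zero_add, abs_mul, hη5 x hxi,
      abs_of_pos hε'] at hlt
    linarith

theorem IsFiniteCSpace.exists_perturbable_rings [NormalSpace X] (h : IsFiniteCSpace X)
    {s : X → ℝ} (hs : Continuous s) :
    ∃ J m : ℕ, ∀ j : ℕ, J ≤ j → Perturbable m {x | (j : ℝ) ≤ s x ∧ s x ≤ j + 1} := by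
  by_contra! hcon
  choose r hr hrP using hcon
  obtain ⟨j, hj0, hjS⟩ : ∃ j : ℕ → ℕ, j 0 = r 0 0 ∧ ∀ m, j (m + 1) = r (j m + 2) (m + 1) :=
    ⟨fun m => Nat.rec (r 0 0) (fun m jm => r (jm + 2) (m + 1)) m, rfl, fun _ => rfl⟩
  have hjP : ∀ m, ¬ Perturbable m {x | (j m : ℝ) ≤ s x ∧ s x ≤ j m + 1} := by
    intro m
    cases m with
    | zero => rw [hj0]; exact hrP 0 0
    | succ m => rw [hjS]; exact hrP (j m + 2) (m + 1)
  have hjs : ∀ m, j m + 2 ≤ j (m + 1) := fun m => by rw [hjS]; exact hr (j m + 2) (m + 1)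
  have hjlt : ∀ a b, a < b → j a + 2 ≤ j b := by
    intro a b hab
    induction b, hab using Nat.le_induction with
    | base => exact hjs a
    | succ b _ ih => have := hjs b; omega
  have hjle : ∀ m, m ≤ j m := by
    intro m
    induction m with
    | zero => omega
    | succ m ih => have := hjs m; omega
  obtain ⟨m, hm⟩ := h.exists_perturbable
    (F := fun m => {x | (j m : ℝ) ≤ s x ∧ s x ≤ j m + 1})
    (fun m => (isClosed_le continuous_const hs).inter (isClosed_le hs continuous_const))
    (by
      intro x
      obtain ⟨n, hn⟩ := exists_nat_gt (s x)
      refine ⟨{y | s y < n}, (isOpen_lt hs continuous_const).mem_nhds hn,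
        (Set.finite_Iio n).subset ?_⟩
      rintro m ⟨y, ⟨hy, -⟩, hyn⟩
      have : ((j m : ℕ) : ℝ) < n := lt_of_le_of_lt hy hyn
      exact lt_of_le_of_lt (hjle m) (Nat.cast_lt.1 this))
    (by
      have hlt : ∀ a b x, a < b → s x ≤ (j a : ℝ) + 1 → (j b : ℝ) ≤ s x → False := by
        intro a b x hab h1 h2
        have := hjlt a b hab
        have : ((j a + 2 : ℕ) : ℝ) ≤ j b := Nat.cast_le.2 this
        push_cast at this
        linarith
      intro a b hab
      refine Set.disjoint_left.2 fun x hx hx' => ?_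
      rcases lt_or_gt_of_ne hab with hab | hab
      · exact hlt a b x hab hx.2 hx'.1
      · exact hlt b a x hab hx'.2 hx.1)
  exact hjP m hm

/-- In paracompact finite C-spaces, the defining property holds for arbitrary open covers. -/
theorem IsFiniteCSpace.exists_disjointRefinements [NormalSpace X] [ParacompactSpace X]
    (h : IsFiniteCSpace X) {U : ℕ → Set (Set X)} (hU : ∀ n, ∀ u ∈ U n, IsOpen u)
    (hcov : ∀ n, ⋃₀ U n = Set.univ) :
    ∃ n : ℕ, ∃ V : ℕ → Set (Set X), (∀ k, IsDisjointRefinement (V k) (U k)) ∧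
      ∀ x, ∃ k ≤ n, x ∈ ⋃₀ V k := by
  choose G hG hGcov using fun n => exists_seq_isDisjointRefinement (hU n) (hcov n)
  have hGo : ∀ n k, IsOpen (⋃₀ G n k) := fun n k => isOpen_sUnion (hG n k).1
  choose s hs hs0 hsG using fun n => exists_continuous_index_bound (hGo n) (hGcov n)
  choose J m hJ using fun n => h.exists_perturbable_rings (hs n)
  obtain ⟨N, V, hVo, hVd, hVr, hVc⟩ := h
    (fun n => insert {x | (J n : ℝ) < s n x} ((fun i => ⋃₀ G n i) '' Set.Iio (J n + 1)))
    fun n => by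
      refine ⟨?_, ((Set.finite_Iio _).image _).insert _, ?_⟩
      · rintro u (rfl | ⟨i, -, rfl⟩)
        exacts [isOpen_lt continuous_const (hs n), hGo n i]
      · refine Set.eq_univ_of_forall fun x => ?_
        by_cases hx : (J n : ℝ) < s n x
        · exact ⟨_, Or.inl rfl, hx⟩
        · obtain ⟨i, hi, hxi⟩ := hsG n x (J n) (by linarith)
          exact ⟨_, Or.inr ⟨i, hi, rfl⟩, hxi⟩
  have hW : ∀ n, ∃ W, IsDisjointRefinement W (U n) ∧
      (n ≤ N → ∀ v ∈ V n, (∃ i, v ⊆ ⋃₀ G n i) → v ⊆ ⋃₀ W) := by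
    intro n
    by_cases hn : n ≤ N
    · obtain ⟨W, hW1, hW2⟩ := exists_isDisjointRefinement_split (hVo n hn) (hVd n hn) (hG n)
      exact ⟨W, hW1, fun _ => hW2⟩
    · exact ⟨∅, isDisjointRefinement_empty _, fun h => absurd h hn⟩
  choose W hW1 hW2 using hW
  let L := ∑ n ∈ Finset.range (N + 1), (m n + m n + (m n + m n))
  let R : Set (Set X) := {w | IsOpen w ∧ ∀ k ∈ Finset.range (N + 1 + L), ∃ u ∈ U k, w ⊆ u}
  have hRcov : ⋃₀ R = Set.univ := by
    refine Set.eq_univ_of_forall fun x => ?_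
    have : ∀ k, ∃ u ∈ U k, x ∈ u := fun k => by
      have : x ∈ ⋃₀ U k := by rw [hcov]; trivial
      exact this
    choose u hu hxu using this
    exact ⟨⋂ k ∈ Finset.range (N + 1 + L), u k,
      ⟨isOpen_biInter_finset fun k _ => hU k _ (hu k),
        fun k hk => ⟨u k, hu k, Set.biInter_subset_of_mem hk⟩⟩,
      Set.mem_biInter fun k _ => hxu k⟩
  obtain ⟨Z, hZ1, hZ2⟩ : HasColoredCover L R
      (⋃ n < N + 1, Set.univ ∩ {x | (J n : ℝ) ≤ s n x}) := by
    refine HasColoredCover.biUnion (N + 1) fun n _ => HasColoredCover.of_rings (hs n) (J n) ?_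
    intro j hj
    refine ((hJ n j hj).hasColoredCover ?_ (fun w hw => hw.1) hRcov).mono Set.inter_subset_right
    exact (isClosed_le continuous_const (hs n)).inter (isClosed_le (hs n) continuous_const)
  refine ⟨N + L, fun k => if k < N + 1 then W k else if k < N + 1 + L then Z (k - (N + 1)) else ∅,
    fun k => ?_, fun x => ?_⟩
  · dsimp only
    split_ifs with h1 h2
    · exact hW1 k
    · refine ⟨(hZ1 _).1, (hZ1 _).2.1, fun v hv => ?_⟩
      obtain ⟨w, hw, hvw⟩ := (hZ1 _).2.2 v hv
      obtain ⟨u, hu, hwu⟩ := hw.2 k (Finset.mem_range.2 h2)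
      exact ⟨u, hu, hvw.trans hwu⟩
    · exact isDisjointRefinement_empty _
  · have hx : x ∈ ⋃ k ≤ N, ⋃₀ V k := by rw [hVc]; trivial
    simp only [Set.mem_iUnion] at hx
    obtain ⟨k, hk, v, hv, hxv⟩ := hx
    rcases hVr k hk v hv with ⟨u, rfl | ⟨i, -, rfl⟩, hvu⟩
    · have hlt : (J k : ℝ) < s k x := hvu hxv
      obtain ⟨l, hl, hxl⟩ := hZ2 x (by
        simp only [Set.mem_iUnion]
        exact ⟨k, by omega, trivial, show (J k : ℝ) ≤ s k x from hlt.le⟩)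
      refine ⟨N + 1 + l, by omega, ?_⟩
      dsimp only
      rw [if_neg (by omega), if_pos (by omega), Nat.add_sub_cancel_left]
      exact hxl
    · refine ⟨k, by omega, ?_⟩
      dsimp only
      rw [if_pos (by omega)]
      exact hW2 k hk v hv ⟨i, hvu⟩ hxv

end FiniteC

section Simplices

variable {V : Type*}

/-- The simplex spanned by `S`, in barycentric coordinates. -/
def simplexOn (S : Finset V) : Set (V → ℝ) :=
  {t | (∀ v, 0 ≤ t v) ∧ (∀ v, v ∉ S → t v = 0) ∧ ∑ v ∈ S, t v = 1}

/-- The boundary of the simplex spanned by `S`. -/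
def simplexBoundary (S : Finset V) : Set (V → ℝ) :=
  {t | t ∈ simplexOn S ∧ ∃ v ∈ S, t v = 0}

theorem isClosed_simplexOn (S : Finset V) : IsClosed (simplexOn S) := by
  have h : simplexOn S = (⋂ v, {t : V → ℝ | 0 ≤ t v}) ∩
      ((⋂ v, ⋂ (_ : v ∉ S), {t : V → ℝ | t v = 0}) ∩ {t : V → ℝ | ∑ v ∈ S, t v = 1}) := by
    ext t
    simp [simplexOn]
  rw [h]
  refine (isClosed_iInter fun v => isClosed_le continuous_const (continuous_apply v)).inter
    ((isClosed_iInter fun v => isClosed_iInter fun _ =>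
      isClosed_eq (continuous_apply v) continuous_const).inter
      (isClosed_eq (continuous_finsetSum S fun v _ => continuous_apply v) continuous_const))

theorem isCompact_simplexOn (S : Finset V) : IsCompact (simplexOn S) := by
  refine (isCompact_univ_pi (s := fun _ : V => Set.Icc (0 : ℝ) 1)
    fun _ => isCompact_Icc).of_isClosed_subset (isClosed_simplexOn S) ?_
  intro t ht v _
  refine ⟨ht.1 v, ?_⟩
  by_cases hv : v ∈ S
  · rw [← ht.2.2]
    exact Finset.single_le_sum (f := t) (fun w _ => ht.1 w) hv
  · rw [ht.2.1 v hv]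
    exact zero_le_one

theorem simplexBoundary_eq_iUnion [DecidableEq V] (S : Finset V) :
    simplexBoundary S = ⋃ v : S, simplexOn (S.erase v) := by
  ext t
  simp only [Set.mem_iUnion]
  constructor
  · rintro ⟨ht, v, hv, hv0⟩
    refine ⟨⟨v, hv⟩, ht.1, fun w hw => ?_, ?_⟩
    · by_cases hwv : w = v
      · rw [hwv, hv0]
      · exact ht.2.1 w fun hwS => hw (Finset.mem_erase.2 ⟨hwv, hwS⟩)
    · rw [Finset.sum_erase _ hv0]
      exact ht.2.2
  · rintro ⟨⟨v, hv⟩, ht⟩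
    have hv0 : t v = 0 := ht.2.1 v (by simp)
    refine ⟨⟨ht.1, fun w hw => ht.2.1 w fun h => hw (Finset.mem_of_mem_erase h), ?_⟩, v, hv, hv0⟩
    rw [← Finset.sum_erase _ hv0]
    exact ht.2.2

theorem simplexOn_empty : simplexOn (∅ : Finset V) = ∅ := by
  ext t
  simp [simplexOn]

theorem EmbedIn.subset {Y : Type*} [TopologicalSpace Y] {k : ℕ} {A B : Set Y}
    (h : EmbedIn k A B) : A ⊆ B := by
  intro y hy
  obtain ⟨g, -, hgB, hg⟩ := h (fun _ => y) continuous_const (by rintro _ ⟨_, rfl⟩; exact hy)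
  obtain ⟨z, hz⟩ := NormedSpace.sphere_nonempty (x := (0 : EuclideanSpace ℝ (Fin (k + 1))))
    (r := 1) |>.2 zero_le_one
  rw [← hg ⟨z, hz⟩]
  exact hgB ⟨_, rfl⟩

/-- Filling of spheres, transported from the Euclidean ball to an abstract simplex. -/
theorem EmbedIn.exists_fill {Y : Type*} [TopologicalSpace Y] {k : ℕ} {A B : Set Y}
    (h : EmbedIn k A B) {S : Finset V} (hS : S.card = k + 2) {b : (V → ℝ) → Y}
    (hb : ContinuousOn b (simplexBoundary S)) (hbA : Set.MapsTo b (simplexBoundary S) A) :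
    ∃ g : (V → ℝ) → Y, ContinuousOn g (simplexOn S) ∧ Set.MapsTo g (simplexOn S) B ∧
      Set.EqOn g b (simplexBoundary S) := by
  classical
  obtain ⟨β⟩ := AffineBasis.exists_affineBasis_of_finiteDimensional (ι := S) (k := ℝ)
    (P := EuclideanSpace ℝ (Fin (k + 1))) (by simp [hS])
  set C := convexHull ℝ (Set.range β) with hC
  have hCeq : C = {x | ∀ i, 0 ≤ β.coord i x} := β.convexHull_eq_nonneg_coord
  have hCint : interior C = {x | ∀ i, 0 < β.coord i x} := β.interior_convexHull
  have hCcpt : IsCompact C := (Set.finite_range β).isCompact_convexHull ℝ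
  have hCcl : closure C = C := hCcpt.isClosed.closure_eq
  obtain ⟨e, -, hecl, hefr⟩ := exists_homeomorph_image_interior_closure_frontier_eq_unitBall
    (convex_convexHull ℝ (Set.range β))
    ⟨_, β.centroid_mem_interior_convexHull⟩ hCcpt.isBounded
  let Ψ : EuclideanSpace ℝ (Fin (k + 1)) → V → ℝ :=
    fun y v => if hv : v ∈ S then β.coord ⟨v, hv⟩ y else 0
  let Θ : (V → ℝ) → EuclideanSpace ℝ (Fin (k + 1)) := fun t => ∑ v : S, t v • β v
  have hΨ : Continuous Ψ := by
    refine continuous_pi fun v => ?_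
    by_cases hv : v ∈ S
    · simpa only [Ψ, dif_pos hv] using continuous_barycentric_coord β ⟨v, hv⟩
    · simpa only [Ψ, dif_neg hv] using continuous_const
  have hΘ : Continuous Θ :=
    continuous_finsetSum _ fun v _ => (continuous_apply (v : V)).smul continuous_const
  have hcoord : ∀ t ∈ simplexOn S, ∀ v : S, β.coord v (Θ t) = t v := by
    intro t ht v
    have hsum : ∑ v : S, t v = 1 := by
      rw [← ht.2.2]
      exact Finset.sum_coe_sort S t
    have := β.coord_apply_combination_of_mem (Finset.mem_univ v) hsum
    rwa [Finset.affineCombination_eq_linear_combination _ _ _ hsum] at this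
  have hΨΘ : ∀ t ∈ simplexOn S, Ψ (Θ t) = t := by
    intro t ht
    ext v
    by_cases hv : v ∈ S
    · simp only [Ψ, dif_pos hv]
      exact hcoord t ht ⟨v, hv⟩
    · simp only [Ψ, dif_neg hv]
      exact (ht.2.1 v hv).symm
  have hΘC : ∀ t ∈ simplexOn S, Θ t ∈ C := by
    intro t ht
    rw [hCeq]
    intro v
    rw [hcoord t ht]
    exact ht.1 v
  have hfr : ∀ y, y ∈ frontier C ↔ y ∈ C ∧ ∃ v, β.coord v y = 0 := by
    intro y
    rw [frontier, hCcl, Set.mem_sdiff, hCint]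
    refine and_congr_right fun hy => ?_
    rw [hCeq] at hy
    simp only [Set.mem_ofPred_eq, not_forall, not_lt]
    exact exists_congr fun v => ⟨fun h => le_antisymm h (hy v), fun h => h.le⟩
  have hΨfr : ∀ y ∈ frontier C, Ψ y ∈ simplexBoundary S := by
    intro y hy
    obtain ⟨hyC, v, hv⟩ := (hfr y).1 hy
    rw [hCeq] at hyC
    refine ⟨⟨fun w => ?_, fun w hw => dif_neg hw, ?_⟩, v, v.2, ?_⟩
    · by_cases hw : w ∈ S
      · simp only [Ψ, dif_pos hw]
        exact hyC ⟨w, hw⟩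
      · simp only [Ψ, dif_neg hw, le_refl]
    · rw [← Finset.sum_coe_sort S (Ψ y), ← β.sum_coord_apply_eq_one y]
      exact Finset.sum_congr rfl fun w _ => dif_pos w.2
    · simpa only [Ψ, dif_pos v.2] using hv
  have hsymm : ∀ z ∈ Metric.sphere (0 : EuclideanSpace ℝ (Fin (k + 1))) 1,
      e.symm z ∈ frontier C := by
    intro z hz
    rw [← hefr] at hz
    obtain ⟨y, hy, rfl⟩ := hz
    rwa [e.symm_apply_apply]
  obtain ⟨g, hg, hgB, hgf⟩ := h (fun z => b (Ψ (e.symm z)))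
    (hb.comp_continuous (hΨ.comp (e.symm.continuous.comp continuous_subtype_val))
      fun z => hΨfr _ (hsymm z z.2))
    (by rintro _ ⟨z, rfl⟩; exact hbA (hΨfr _ (hsymm z z.2)))
  have hball : ∀ t ∈ simplexOn S,
      e (Θ t) ∈ Metric.closedBall (0 : EuclideanSpace ℝ (Fin (k + 1))) 1 := by
    intro t ht
    rw [← hecl]
    exact ⟨_, subset_closure (hΘC t ht), rfl⟩
  refine ⟨fun t => if ht : t ∈ simplexOn S then g ⟨e (Θ t), hball t ht⟩ else b t, ?_, ?_, ?_⟩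
  · rw [continuousOn_iff_continuous_domRestrict]
    have : Continuous fun t : simplexOn S => g ⟨e (Θ t), hball t t.2⟩ :=
      hg.comp ((e.continuous.comp (hΘ.comp continuous_subtype_val)).subtype_mk _)
    convert this with t
    simp only [Set.domRestrict_apply, dif_pos t.2]
  · intro t ht
    simp only [dif_pos ht]
    exact hgB ⟨_, rfl⟩
  · intro t ht
    obtain ⟨ht, v, hv, hv0⟩ := ht
    simp only [dif_pos ht]
    have hfrt : Θ t ∈ frontier C :=
      (hfr _).2 ⟨hΘC t ht, ⟨v, hv⟩, by rw [hcoord t ht]; exact hv0⟩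
    have hsph : e (Θ t) ∈ Metric.sphere (0 : EuclideanSpace ℝ (Fin (k + 1))) 1 := by
      rw [← hefr]
      exact ⟨_, hfrt, rfl⟩
    have := hgf ⟨e (Θ t), hsph⟩
    simp only [e.symm_apply_apply, hΨΘ t ht] at this
    exact this

/-- If every continuous map on the boundary of a simplex with values in the prescribed set can be
filled, then the fillings can be chosen to fit together. -/
theorem exists_coherent_fill {Y : Type*} [TopologicalSpace Y] [Nonempty Y]
    {A B : Finset V → Set Y}
    (hfill : ∀ S : Finset V, S.Nonempty → ∀ b : (V → ℝ) → Y, ContinuousOn b (simplexBoundary S) →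
      Set.MapsTo b (simplexBoundary S) (A S) → ∃ g : (V → ℝ) → Y, ContinuousOn g (simplexOn S) ∧
        Set.MapsTo g (simplexOn S) (B S) ∧ Set.EqOn g b (simplexBoundary S)) :
    ∃ U : (V → ℝ) → Y, ∀ S : Finset V, S.Nonempty → ContinuousOn U (simplexBoundary S) →
      Set.MapsTo U (simplexBoundary S) (A S) →
        ContinuousOn U (simplexOn S) ∧ Set.MapsTo U (simplexOn S) (B S) := by
  classical
  have hfill' : ∀ (S : Finset V) (b : (V → ℝ) → Y), ∃ g : (V → ℝ) → Y, S.Nonempty →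
      ContinuousOn b (simplexBoundary S) → Set.MapsTo b (simplexBoundary S) (A S) →
        ContinuousOn g (simplexOn S) ∧ Set.MapsTo g (simplexOn S) (B S) ∧
          Set.EqOn g b (simplexBoundary S) := by
    intro S b
    by_cases hS : S.Nonempty ∧ ContinuousOn b (simplexBoundary S) ∧
      Set.MapsTo b (simplexBoundary S) (A S)
    · obtain ⟨g, hg⟩ := hfill S hS.1 b hS.2.1 hS.2.2
      exact ⟨g, fun _ _ _ => hg⟩
    · exact ⟨b, fun h1 h2 h3 => absurd ⟨h1, h2, h3⟩ hS⟩
  choose fill hfill' using hfill'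
  let supp : (V → ℝ) → Finset V := fun t =>
    if h : (Function.support t).Finite then h.toFinset else ∅
  have hsupp : ∀ S, ∀ t ∈ simplexOn S, ∀ v, v ∈ supp t ↔ t v ≠ 0 := by
    intro S t ht v
    have hfin : (Function.support t).Finite := S.finite_toSet.subset fun w hw => by
      by_contra hwS
      exact hw (ht.2.1 w hwS)
    simp [supp, dif_pos hfin]
  have hsub : ∀ S, ∀ t ∈ simplexOn S, supp t ⊆ S := by
    intro S t ht v hv
    by_contra hvS
    exact (hsupp S t ht v).1 hv (ht.2.1 v hvS)
  let u : Finset V → (V → ℝ) → Y := fun S => Finset.strongInduction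
    (p := fun _ => (V → ℝ) → Y)
    (fun S ih => fill S fun t => if h : supp t ⊂ S then ih (supp t) h t else Classical.ofNonempty) S
  have hu : ∀ S, u S = fill S
      (fun t => if supp t ⊂ S then u (supp t) t else Classical.ofNonempty) := by
    intro S
    simp only [u]
    rw [Finset.strongInduction_eq]
    rfl
  refine ⟨fun t => u (supp t) t, fun S hS hc hm => ?_⟩
  have hbd : Set.EqOn (fun t => if supp t ⊂ S then u (supp t) t else Classical.ofNonempty)
      (fun t => u (supp t) t) (simplexBoundary S) := by
    rintro t ⟨ht, v, hv, hv0⟩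
    have : supp t ⊂ S := by
      refine Finset.ssubset_iff_subset_ne.2 ⟨hsub S t ht, fun heq => ?_⟩
      rw [← heq] at hv
      exact (hsupp S t ht v).1 hv hv0
    simp only [if_pos this]
  obtain ⟨h1, h2, h3⟩ := hfill' S _ hS (hc.congr hbd) (hm.congr hbd.symm)
  rw [← hu] at h1 h2 h3
  have hU : Set.EqOn (fun t => u (supp t) t) (u S) (simplexOn S) := by
    intro t ht
    by_cases hs : supp t = S
    · simp only [hs]
    · refine ((h3 ?_).trans (hbd ?_)).symm <;>
      · refine ⟨ht, ?_⟩
        by_contra! hne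
        exact hs ((hsub S t ht).antisymm fun v hv => (hsupp S t ht v).2 (hne v hv))
  exact ⟨h1.congr hU, h2.congr hU.symm⟩

end Simplices

section Selection

variable {X Y : Type*} [TopologicalSpace Y]

/-- Locally finite open covers with prescribed neighbourhoods can be chosen recursively. -/
theorem exists_seq_locallyFinite_cover [TopologicalSpace X] [NormalSpace X] [ParacompactSpace X]
    (O : (ℕ → X → Set X) → ℕ → X → Set X)
    (hdep : ∀ W W' : ℕ → X → Set X, ∀ k, (∀ j < k, W j = W' j) → O W k = O W' k)
    (hmem : ∀ W k x, x ∈ O W k x)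
    (hopen : ∀ W : ℕ → X → Set X, (∀ k, LocallyFinite (W k)) → ∀ k x, IsOpen (O W k x)) :
    ∃ W : ℕ → X → Set X, (∀ k x, IsOpen (W k x)) ∧ (∀ k, ⋃ x, W k x = Set.univ) ∧
      (∀ k, LocallyFinite (W k)) ∧ ∀ k x, closure (W k x) ⊆ O W k x := by
  classical
  have hpick : ∀ (W : ℕ → X → Set X) (k : ℕ), ∃ w : X → Set X, (∀ x, IsOpen (w x)) ∧
      ⋃ x, w x = Set.univ ∧ LocallyFinite w ∧
        ((∀ k, LocallyFinite (W k)) → ∀ x, closure (w x) ⊆ O W k x) := by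
    intro W k
    let o : X → Set X := fun x => if ∀ k, LocallyFinite (W k) then O W k x else Set.univ
    obtain ⟨v, hvo, hvc, hvl, hvs⟩ := precise_refinement o
      (by
        intro x
        by_cases h : ∀ k, LocallyFinite (W k)
        · simpa only [o, if_pos h] using hopen W h k x
        · simpa only [o, if_neg h] using isOpen_univ)
      (by
        refine Set.eq_univ_of_forall fun x => Set.mem_iUnion.2 ⟨x, ?_⟩
        by_cases h : ∀ k, LocallyFinite (W k)
        · simpa only [o, if_pos h] using hmem W k x
        · simp only [o, if_neg h, Set.mem_univ])
    obtain ⟨w, hwc, hwo, hws⟩ := exists_iUnion_eq_closure_subset hvo hvl.point_finite hvc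
    refine ⟨w, hwo, hwc, hvl.subset fun x => subset_closure.trans (hws x), fun h x => ?_⟩
    have := (hws x).trans (hvs x)
    simpa only [o, if_pos h] using this
  choose pick hpo hpc hpl hps using hpick
  let W : ℕ → X → Set X := Nat.lt_wfRel.wf.fix fun k ih =>
    pick (fun j => if h : j < k then ih j h else fun _ => ∅) k
  have hW : ∀ k, W k = pick (fun j => if j < k then W j else fun _ => ∅) k := by
    intro k
    simp only [W]
    rw [WellFounded.fix_eq]
    rfl
  have hWl : ∀ k, LocallyFinite (W k) := by
    intro k
    rw [hW]
    exact hpl _ _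
  refine ⟨W, fun k x => ?_, fun k => ?_, hWl, fun k x => ?_⟩
  · rw [hW]
    exact hpo _ _ x
  · rw [hW]
    exact hpc _ _
  · rw [hdep W (fun j => if j < k then W j else fun _ => ∅) k fun j hj => by simp only [if_pos hj]]
    rw [hW k]
    refine hps _ _ (fun j => ?_) x
    by_cases hj : j < k
    · simpa only [if_pos hj] using hWl j
    · simp only [if_neg hj]
      exact fun x => ⟨Set.univ, Filter.univ_mem, by simp⟩

/-- The points `z` where all fillings over simplices with top vertex `(k, x)` and remaining
vertices of lower level keep their values, and which meet only the lower level sets `C j x'`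
containing `x`. -/
def starNhd (φ : ℕ → X → Set Y) (U : (ℕ × X → ℝ) → Y) (C : ℕ → X → Set X) (k : ℕ) (x : X) :
    Set X :=
  {z | (∀ S : Finset (ℕ × X), (∀ q ∈ S, q ≠ (k, x) → q.1 < k ∧ x ∈ C q.1 q.2) →
      ContinuousOn U (simplexOn S) → Set.MapsTo U (simplexOn S) (φ (S.card - 1) x) →
        Set.MapsTo U (simplexOn S) (φ (S.card - 1) z)) ∧
    ∀ j < k, ∀ x', z ∈ C j x' → x ∈ C j x'}

theorem mem_starNhd (φ : ℕ → X → Set Y) (U : (ℕ × X → ℝ) → Y) (C : ℕ → X → Set X) (k : ℕ)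
    (x : X) : x ∈ starNhd φ U C k x :=
  ⟨fun _ _ _ h => h, fun _ _ _ h => h⟩

theorem starNhd_congr (φ : ℕ → X → Set Y) (U : (ℕ × X → ℝ) → Y) {C C' : ℕ → X → Set X} {k : ℕ}
    (h : ∀ j < k, C j = C' j) (x : X) : starNhd φ U C k x ⊆ starNhd φ U C' k x := by
  rintro z ⟨h1, h2⟩
  refine ⟨fun S hS => h1 S fun q hq hne => ?_, fun j hj x' hx' => ?_⟩
  · obtain ⟨h3, h4⟩ := hS q hq hne
    rw [← h _ h3] at h4
    exact ⟨h3, h4⟩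
  · rw [← h j hj] at hx' ⊢
    exact h2 j hj x' hx'

theorem isOpen_starNhd [TopologicalSpace X] {φ : ℕ → X → Set Y}
    (hφ : ∀ k, LowerLocallyConstant (φ k)) (U : (ℕ × X → ℝ) → Y) {C : ℕ → X → Set X}
    (hC : ∀ j x, IsClosed (C j x))
    (hCl : ∀ j, LocallyFinite (C j)) (k : ℕ) (x : X) : IsOpen (starNhd φ U C k x) := by
  classical
  let Q : Set (ℕ × X) := insert (k, x) {q | q.1 < k ∧ x ∈ C q.1 q.2}
  have hQ : Q.Finite := by
    refine Set.Finite.insert _ (((Set.finite_Iio k).biUnion fun j _ =>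
      ((hCl j).point_finite x).image (Prod.mk j)).subset ?_)
    rintro ⟨j, x'⟩ ⟨hj, hx'⟩
    exact Set.mem_biUnion hj ⟨x', hx', rfl⟩
  have heq : starNhd φ U C k x =
      (⋂ S ∈ {S : Finset (ℕ × X) | (∀ q ∈ S, q ≠ (k, x) → q.1 < k ∧ x ∈ C q.1 q.2)},
        {z | ContinuousOn U (simplexOn S) → Set.MapsTo U (simplexOn S) (φ (S.card - 1) x) →
          Set.MapsTo U (simplexOn S) (φ (S.card - 1) z)}) ∩
      ⋂ j ∈ Set.Iio k, (⋃ x' : {x' // x ∉ C j x'}, C j x')ᶜ := by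
    ext z
    simp only [starNhd, Set.mem_inter_iff, Set.mem_iInter, Set.mem_ofPred_eq, Set.mem_compl_iff,
      Set.mem_iUnion, Set.mem_Iio, not_exists, Subtype.forall]
    refine and_congr_right fun _ => forall₂_congr fun j hj => forall_congr' fun x' => ?_
    tauto
  rw [heq]
  refine IsOpen.inter (Set.Finite.isOpen_biInter ?_ fun S _ => ?_)
    ((Set.finite_Iio k).isOpen_biInter fun j _ => ?_)
  · refine hQ.toFinset.powerset.finite_toSet.subset fun S hS => ?_
    rw [Finset.mem_coe, Finset.mem_powerset]
    intro q hq
    rw [Set.Finite.mem_toFinset]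
    by_cases hne : q = (k, x)
    · exact Or.inl hne
    · exact Or.inr (hS q hq hne)
  · by_cases h1 : ContinuousOn U (simplexOn S)
    · by_cases h2 : Set.MapsTo U (simplexOn S) (φ (S.card - 1) x)
      · simpa only [h1, h2, forall_const, Set.mapsTo_iff_image_subset] using
          hφ (S.card - 1) _ ((isCompact_simplexOn S).image_of_continuousOn h1)
      · simp [h2]
    · simp [h1]
  · exact (((hCl j).comp_injective Subtype.val_injective).isClosed_iUnion
      fun x' => hC j x'.1).isOpen_compl

/-- Coherent fillings take values in the right members of the sequence over simplices whose
vertices index sets with a common point. -/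
theorem mapsTo_of_subset_starNhd {φ : ℕ → X → Set Y} {U : (ℕ × X → ℝ) → Y} {W C : ℕ → X → Set X}
    (hWC : ∀ k x, W k x ⊆ C k x) (hC : ∀ k x, C k x ⊆ starNhd φ U C k x)
    {top : Finset (ℕ × X) → ℕ × X}
    (htop : ∀ S : Finset (ℕ × X), S.Nonempty → top S ∈ S ∧ ∀ q ∈ S, q.1 ≤ (top S).1)
    (hU : ∀ S : Finset (ℕ × X), S.Nonempty → ContinuousOn U (simplexBoundary S) →
      Set.MapsTo U (simplexBoundary S) (φ (S.card - 2) (top S).2) →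
        ContinuousOn U (simplexOn S) ∧ Set.MapsTo U (simplexOn S) (φ (S.card - 1) (top S).2))
    (S : Finset (ℕ × X)) (hS : S.Nonempty) (hinj : Set.InjOn Prod.fst (S : Set (ℕ × X))) {z₀ : X}
    (hz₀ : ∀ p ∈ S, z₀ ∈ W p.1 p.2) :
    ContinuousOn U (simplexOn S) ∧ ∀ z ∈ starNhd φ U C (top S).1 (top S).2,
      Set.MapsTo U (simplexOn S) (φ (S.card - 1) z) := by
  classical
  induction S using Finset.strongInduction with
  | H S ih =>
    obtain ⟨hp, hmax⟩ := htop S hS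
    have hlt : ∀ q ∈ S, q ≠ top S → q.1 < (top S).1 ∧ (top S).2 ∈ C q.1 q.2 := by
      intro q hq hne
      have hlt : q.1 < (top S).1 :=
        lt_of_le_of_ne (hmax q hq) fun heq => hne (hinj hq hp heq)
      exact ⟨hlt, (hC _ _ (hWC _ _ (hz₀ _ hp))).2 q.1 hlt q.2 (hWC _ _ (hz₀ q hq))⟩
    have hface : ∀ v : S, ContinuousOn U (simplexOn (S.erase v)) ∧
        Set.MapsTo U (simplexOn (S.erase v)) (φ (S.card - 2) (top S).2) := by
      rintro ⟨v, hv⟩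
      rcases (S.erase v).eq_empty_or_nonempty with he | hne
      · simp only [he, simplexOn_empty]
        exact ⟨continuousOn_empty U, Set.mapsTo_empty U _⟩
      · obtain ⟨h1, h2⟩ := ih (S.erase v) (Finset.erase_ssubset hv) hne
          (hinj.mono (Finset.coe_subset.2 (Finset.erase_subset v S)))
          (fun p hp => hz₀ p (Finset.mem_of_mem_erase hp))
        refine ⟨h1, ?_⟩
        have hcard : S.card - 2 = (S.erase v).card - 1 := by
          rw [Finset.card_erase_of_mem hv]
          omega
        rw [hcard]
        refine h2 _ ?_
        obtain ⟨hp', hmax'⟩ := htop _ hne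
        by_cases heq : top (S.erase v) = top S
        · rw [heq]
          exact mem_starNhd _ _ _ _ _
        · exact hC _ _ (hlt _ (Finset.mem_of_mem_erase hp') heq).2
    obtain ⟨h1, h2⟩ := hU S hS
      (by
        rw [simplexBoundary_eq_iUnion]
        exact (locallyFinite_of_finite _).continuousOn_iUnion (fun v => isClosed_simplexOn _)
          fun v => (hface v).1)
      (by
        rw [simplexBoundary_eq_iUnion]
        exact Set.mapsTo_iUnion.2 fun v => (hface v).2)
    exact ⟨h1, fun z hz => hz.1 S hlt h1 h2⟩

theorem IsFiniteCSpace.exists_continuous_selection [TopologicalSpace X] [T2Space X]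
    [ParacompactSpace X] (h : IsFiniteCSpace X) {φ : ℕ → X → Set Y}
    (hne : ∀ k x, (φ k x).Nonempty) (hφ : ∀ k, LowerLocallyConstant (φ k))
    (hemb : ∀ k x, EmbedIn k (φ k x) (φ (k + 1) x)) :
    ∃ n : ℕ, ∃ f : X → Y, Continuous f ∧ ∀ x, f x ∈ φ n x := by
  classical
  rcases isEmpty_or_nonempty X with hX | hX
  · exact ⟨0, fun x => isEmptyElim x, continuous_of_const fun x => isEmptyElim x,
      fun x => isEmptyElim x⟩
  have hY : Nonempty Y := ⟨(hne 0 hX.some).some⟩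
  have hmono : ∀ x, Monotone fun k => φ k x := fun x =>
    monotone_nat_of_le_succ fun k => (hemb k x).subset
  have htop : ∀ S : Finset (ℕ × X), ∃ p, S.Nonempty → p ∈ S ∧ ∀ q ∈ S, q.1 ≤ p.1 := by
    intro S
    by_cases hS : S.Nonempty
    · obtain ⟨p, hp, hmax⟩ := S.exists_max_image Prod.fst hS
      exact ⟨p, fun _ => ⟨hp, hmax⟩⟩
    · exact ⟨(0, hX.some), fun h => absurd h hS⟩
  choose top htop using htop
  obtain ⟨U, hU⟩ := exists_coherent_fill (V := ℕ × X)
    (A := fun S => φ (S.card - 2) (top S).2) (B := fun S => φ (S.card - 1) (top S).2)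
    (by
      intro S hS b hb hbA
      obtain hS1 | hS2 : S.card = 1 ∨ 2 ≤ S.card := by
        have := hS.card_pos
        omega
      · obtain ⟨y, hy⟩ := hne (S.card - 1) (top S).2
        refine ⟨fun _ => y, continuousOn_const, fun _ _ => hy, ?_⟩
        obtain ⟨v, rfl⟩ := Finset.card_eq_one.1 hS1
        rintro t ⟨ht, w, hw, hw0⟩
        have := ht.2.2
        rw [Finset.mem_singleton] at hw
        rw [Finset.sum_singleton, ← hw, hw0] at this
        exact absurd this zero_ne_one
      · obtain ⟨k, hk⟩ := Nat.exists_eq_add_of_le' hS2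
        have h1 : S.card - 2 = k := by omega
        have h2 : S.card - 1 = k + 1 := by omega
        rw [h1] at hbA
        rw [h2]
        exact (hemb k _).exists_fill hk hb hbA)
  obtain ⟨W, hWo, hWc, -, hWs⟩ := exists_seq_locallyFinite_cover
    (fun W => starNhd φ U fun j x => closure (W j x))
    (by
      intro W W' k hWW'
      ext1 x
      have : ∀ j < k, (fun x => closure (W j x)) = fun x => closure (W' j x) := fun j hj => by
        rw [hWW' j hj]
      exact (starNhd_congr φ U this x).antisymm
        (starNhd_congr φ U (fun j hj => (this j hj).symm) x))
    (fun W k x => mem_starNhd _ _ _ _ _)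
    (fun W hW k x => isOpen_starNhd hφ U (fun _ _ => isClosed_closure)
      (fun j => (hW j).closure) k x)
  have hclaim := mapsTo_of_subset_starNhd (fun k x => subset_closure) hWs htop hU
  obtain ⟨n, V, hV, hVc⟩ := h.exists_disjointRefinements (U := fun k => Set.range (W k))
    (by rintro k _ ⟨x, rfl⟩; exact hWo k x) (fun k => by rw [Set.sUnion_range, hWc])
  have hDo : ∀ i, IsOpen (⋃₀ V i) := fun i => isOpen_sUnion (hV i).1
  have ha : ∀ i, ∃ a : X → X, ∀ x ∈ ⋃₀ V i, x ∈ W i (a x) ∧ ∀ᶠ y in nhds x, a y = a x := by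
    intro i
    have h1 : ∀ v, ∃ x, v ∈ V i → v ⊆ W i x := by
      intro v
      by_cases hv : v ∈ V i
      · obtain ⟨_, ⟨x, rfl⟩, hx⟩ := (hV i).2.2 v hv
        exact ⟨x, fun _ => hx⟩
      · exact ⟨hX.some, fun h => absurd h hv⟩
    choose α hα using h1
    have h2 : ∀ x, ∃ v, x ∈ ⋃₀ V i → v ∈ V i ∧ x ∈ v := by
      intro x
      by_cases hx : x ∈ ⋃₀ V i
      · obtain ⟨v, hv⟩ := hx
        exact ⟨v, fun _ => hv⟩
      · exact ⟨∅, fun h => absurd h hx⟩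
    choose c hc using h2
    refine ⟨fun x => α (c x), fun x hx => ⟨hα _ (hc x hx).1 (hc x hx).2, ?_⟩⟩
    filter_upwards [((hV i).1 _ (hc x hx).1).mem_nhds (hc x hx).2] with y hy
    have hyD : y ∈ ⋃₀ V i := ⟨_, (hc x hx).1, hy⟩
    congr 1
    by_contra hne
    exact Set.disjoint_left.1 ((hV i).2.1 (hc y hyD).1 (hc x hx).1 hne) (hc y hyD).2 hy
  choose a ha using ha
  obtain ⟨P, hP⟩ := PartitionOfUnity.exists_isSubordinate (isClosed_univ (X := X))
    (fun i : Fin (n + 1) => ⋃₀ V i) (fun i => hDo i) (by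
      intro x _
      obtain ⟨k, hk, hxk⟩ := hVc x
      exact Set.mem_iUnion.2 ⟨⟨k, by omega⟩, hxk⟩)
  let p : ℕ → X → ℝ := fun i => if hi : i < n + 1 then P ⟨i, hi⟩ else 0
  have hpc : ∀ i, Continuous (p i) := by
    intro i
    by_cases hi : i < n + 1
    · simpa only [p, dif_pos hi] using (P ⟨i, hi⟩).continuous
    · simpa only [p, dif_neg hi] using continuous_zero
  have hp0 : ∀ i x, 0 ≤ p i x := by
    intro i x
    by_cases hi : i < n + 1
    · simpa only [p, dif_pos hi] using P.nonneg ⟨i, hi⟩ x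
    · simp only [p, dif_neg hi, Pi.zero_apply, le_refl]
  have hpn : ∀ i x, n < i → p i x = 0 := by
    intro i x hi
    simp only [p, dif_neg (show ¬ i < n + 1 by omega), Pi.zero_apply]
  have hpD : ∀ i x, x ∉ ⋃₀ V i → ∀ᶠ y in nhds x, p i y = 0 := by
    intro i x hx
    by_cases hi : i < n + 1
    · have hxt : x ∉ tsupport (P ⟨i, hi⟩) := fun h => hx (hP ⟨i, hi⟩ h)
      filter_upwards [notMem_tsupport_iff_eventuallyEq.1 hxt] with y hy
      simpa only [p, dif_pos hi, Pi.zero_apply] using hy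
    · simp only [p, dif_neg hi, Pi.zero_apply, Filter.eventually_true]
  have hp1 : ∀ x, ∑ i ∈ Finset.range (n + 1), p i x = 1 := by
    intro x
    rw [← P.sum_eq_one (Set.mem_univ x), finsum_eq_sum_of_fintype, Finset.sum_range]
    exact Finset.sum_congr rfl fun i _ => by simp only [p, dif_pos i.2]
  let F : X → ℕ × X → ℝ := fun x q => if q.2 = a q.1 x then p q.1 x else 0
  let S : X → Finset (ℕ × X) := fun x =>
    ((Finset.range (n + 1)).filter fun i => x ∈ ⋃₀ V i).image fun i => (i, a i x)
  have hSmem : ∀ x q, q ∈ S x ↔ q.1 ≤ n ∧ x ∈ ⋃₀ V q.1 ∧ q.2 = a q.1 x := by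
    rintro x ⟨i, y⟩
    simp only [S, Finset.mem_image, Finset.mem_filter, Finset.mem_range, Prod.mk.injEq]
    constructor
    · rintro ⟨j, ⟨h1, h2⟩, rfl, rfl⟩
      exact ⟨by omega, h2, rfl⟩
    · rintro ⟨h1, h2, rfl⟩
      exact ⟨i, ⟨by omega, h2⟩, rfl, rfl⟩
  have hlocal : ∀ x₀, ∀ᶠ x in nhds x₀,
      (F x = fun q => if q.2 = a q.1 x₀ then p q.1 x else 0) ∧ F x ∈ simplexOn (S x₀) := by
    intro x₀
    have hev : ∀ᶠ x in nhds x₀, ∀ i ∈ Finset.range (n + 1),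
        (x₀ ∈ ⋃₀ V i → a i x = a i x₀) ∧ (x₀ ∉ ⋃₀ V i → p i x = 0) := by
      refine (Filter.eventually_all_finset _).2 fun i _ => ?_
      by_cases hx : x₀ ∈ ⋃₀ V i
      · filter_upwards [(ha i x₀ hx).2] with x h
        exact ⟨fun _ => h, fun h' => absurd hx h'⟩
      · filter_upwards [hpD i x₀ hx] with x h
        exact ⟨fun h' => absurd h' hx, fun _ => h⟩
    filter_upwards [hev] with x hx
    have hF : F x = fun q => if q.2 = a q.1 x₀ then p q.1 x else 0 := by
      ext q
      by_cases hq : q.1 < n + 1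
      · by_cases hD : x₀ ∈ ⋃₀ V q.1
        · simp only [F, (hx q.1 (Finset.mem_range.2 hq)).1 hD]
        · simp only [F, (hx q.1 (Finset.mem_range.2 hq)).2 hD, ite_self]
      · simp only [F, hpn q.1 x (by omega), ite_self]
    refine ⟨hF, fun q => ?_, fun q hq => ?_, ?_⟩
    · simp only [F]
      split_ifs
      exacts [hp0 _ _, le_refl _]
    · simp only [hF]
      split_ifs with h1
      · by_cases h2 : q.1 < n + 1
        · exact (hx q.1 (Finset.mem_range.2 h2)).2 fun h3 =>
            hq ((hSmem x₀ q).2 ⟨by omega, h3, h1⟩)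
        · exact hpn _ _ (by omega)
      · rfl
    · rw [hF]
      simp only [S]
      rw [Finset.sum_image fun i _ j _ hij => (Prod.mk.inj hij).1]
      simp only [if_true]
      rw [← hp1 x]
      refine Finset.sum_filter_of_ne fun i hi hne => ?_
      by_contra hD
      exact hne ((hx i hi).2 hD)
  have hSW : ∀ x, ∀ q ∈ S x, x ∈ W q.1 q.2 := by
    intro x q hq
    obtain ⟨-, h2, h3⟩ := (hSmem x q).1 hq
    rw [h3]
    exact (ha q.1 x h2).1
  have hSne : ∀ x, (S x).Nonempty := by
    intro x
    obtain ⟨k, hk, hxk⟩ := hVc x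
    exact ⟨(k, a k x), (hSmem x _).2 ⟨hk, hxk, rfl⟩⟩
  have hSinj : ∀ x, Set.InjOn Prod.fst (S x : Set (ℕ × X)) := by
    intro x q hq q' hq' heq
    refine Prod.ext heq ?_
    rw [((hSmem x q).1 hq).2.2, ((hSmem x q').1 hq').2.2, heq]
  have hScard : ∀ x, (S x).card ≤ n + 1 := fun x =>
    Finset.card_image_le.trans ((Finset.card_filter_le _ _).trans (Finset.card_range _).le)
  refine ⟨n, fun x => U (F x), continuous_iff_continuousAt.2 fun x₀ => ?_, fun x => ?_⟩
  · obtain ⟨h1, -⟩ := hclaim (S x₀) (hSne x₀) (hSinj x₀) (hSW x₀)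
    have h2 := h1 (F x₀) (hlocal x₀).self_of_nhds.2
    refine h2.tendsto.comp (tendsto_nhdsWithin_iff.2 ⟨?_, (hlocal x₀).mono fun x hx => hx.2⟩)
    have h3 : ContinuousAt
        (fun x => fun q : ℕ × X => if q.2 = a q.1 x₀ then p q.1 x else 0) x₀ := by
      refine (continuous_pi fun q => ?_).continuousAt
      split_ifs
      exacts [hpc _, continuous_const]
    exact h3.congr ((hlocal x₀).mono fun x hx => hx.1.symm)
  · obtain ⟨-, h2⟩ := hclaim (S x) (hSne x) (hSinj x) (hSW x)
    have h3 := h2 x (hWs _ _ (subset_closure (hSW x _ (htop _ (hSne x)).1)))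
      (hlocal x).self_of_nhds.2
    exact hmono x (by have := hScard x; omega) h3

end Selection

/-- A paracompact Hausdorff space is a finite C-space iff for every aspherical sequence
of lower locally constant mappings into any Hausdorff space, some member of the
sequence has a continuous selection. -/
theorem finiteCSpace_iff_asphericalSequence_member_selection
    {X : Type*} [TopologicalSpace X] [T2Space X] [ParacompactSpace X] :
    IsFiniteCSpace X ↔
      ∀ (Y : Type) [TopologicalSpace Y] [T2Space Y] (φ : ℕ → X → Set Y),
        (∀ k x, (φ k x).Nonempty) →
        (∀ k, LowerLocallyConstant (φ k)) →
        (∀ k x, EmbedIn k (φ k x) (φ (k + 1) x)) →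
        ∃ n : ℕ, ∃ f : X → Y, Continuous f ∧ ∀ x, f x ∈ φ n x := by
  refine ⟨fun h Y _ _ φ hne hφ hemb => h.exists_continuous_selection hne hφ hemb, fun h => ?_⟩
  exact isFiniteCSpace_of_selection h
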